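/- Fix an integer k ≥ 2 and a real number c > 0, and for each n set t_n = ⌊cn + (n/2)·ln k⌋. Then liminf_{n→∞} ‖μ_{t_n+1} − U_{t_n+1}‖_TV ≥ (1/12)·e^{−4c} and limsup_{n→∞} ‖μ_{t_n+1} − U_{t_n+1}‖_TV ≤ √((e−1)/2)·e^{−2c}. -/

import Mathlib

-- Common setup for the random (n-k)-cycle to transpositions walk on the symmetric group.
open Finset Filter Real

noncomputable section

/-- Convolution of two (probability) distributions on `S_n`. -/
def conv {n : ℕ} (μ ν : Equiv.Perm (Fin n) → ℝ) : Equiv.Perm (Fin n) → ℝ :=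
  fun g => ∑ h : Equiv.Perm (Fin n), μ (g * h⁻¹) * ν h

/-- `t`-fold convolution power (with `μ^{*0}` the point mass at the identity). -/
def convPow {n : ℕ} (μ : Equiv.Perm (Fin n) → ℝ) : ℕ → (Equiv.Perm (Fin n) → ℝ)
  | 0 => fun g => if g = 1 then 1 else 0
  | t + 1 => conv (convPow μ t) μ

/-- Uniform probability distribution on a finite set of permutations. -/
def unifOn {n : ℕ} (S : Finset (Equiv.Perm (Fin n))) : Equiv.Perm (Fin n) → ℝ :=
  fun g => if g ∈ S then (1 : ℝ) / S.card else 0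

/-- The set of `(n-k)`-cycles of `S_n`: one cycle of length `n - k` and `k` fixed points. -/
def cycles (n k : ℕ) : Finset (Equiv.Perm (Fin n)) :=
  letI := Classical.decPred fun σ : Equiv.Perm (Fin n) => σ.IsCycle ∧ σ.support.card = n - k
  Finset.univ.filter fun σ : Equiv.Perm (Fin n) => σ.IsCycle ∧ σ.support.card = n - k

/-- The set of transpositions of `S_n`. -/
def transpositions (n : ℕ) : Finset (Equiv.Perm (Fin n)) :=
  letI := Classical.decPred fun σ : Equiv.Perm (Fin n) => σ.IsSwap
  Finset.univ.filter fun σ : Equiv.Perm (Fin n) => σ.IsSwap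

/-- The law `μ_{t+1} = ν_n * τ_n^{*t}` of the walk after the initial random `(n-k)`-cycle
and `t` random transpositions. -/
def walk (n k t : ℕ) : Equiv.Perm (Fin n) → ℝ :=
  conv (unifOn (cycles n k)) (convPow (unifOn (transpositions n)) t)

/-- The alternating group `A_n` as a finset. -/
def evenPerms (n : ℕ) : Finset (Equiv.Perm (Fin n)) :=
  Finset.univ.filter fun σ => Equiv.Perm.sign σ = 1

/-- `S_n \ A_n` as a finset. -/
def oddPerms (n : ℕ) : Finset (Equiv.Perm (Fin n)) :=
  Finset.univ.filter fun σ => ¬ (Equiv.Perm.sign σ = 1)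

/-- The stationary distribution `U_s` at step `s`: uniform on `A_n` if `s` and `n - k`
have the same parity, uniform on `S_n \ A_n` otherwise. -/
def stationary (n k s : ℕ) : Equiv.Perm (Fin n) → ℝ :=
  if s % 2 = (n - k) % 2 then unifOn (evenPerms n) else unifOn (oddPerms n)

/-- Total variation distance between two distributions on `S_n`. -/
def tvDist {n : ℕ} (μ ν : Equiv.Perm (Fin n) → ℝ) : ℝ :=
  (1 / 2) * ∑ σ : Equiv.Perm (Fin n), |μ σ - ν σ|

/-- The number of fixed points of a permutation. -/
def fixCount {n : ℕ} (σ : Equiv.Perm (Fin n)) : ℕ :=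
  (Finset.univ.filter fun i => σ i = i).card

end

open Finset Filter Real

namespace HookWalk
open scoped PowerSeries
open Equiv

section matrixpart
variable {α : Type*} [Fintype α] [DecidableEq α]

/-- permutation matrix over power series -/
noncomputable def PM (σ : Perm α) : Matrix α α ℝ⟦X⟧ := fun i j => if i = σ j then 1 else 0

noncomputable def MM (σ : Perm α) : Matrix α α ℝ⟦X⟧ := 1 - (PowerSeries.X : ℝ⟦X⟧) • PM σ

noncomputable def Q (σ : Perm α) : ℝ⟦X⟧ := (MM σ).det

noncomputable def NN (σ : Perm α) : Matrix α α ℝ⟦X⟧ := (MM σ)⁻¹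

lemma PM_mul (σ τ : Perm α) : PM (σ * τ) = PM σ * PM τ := by
  refine Matrix.ext fun i j => ?_
  rw [Matrix.mul_apply, Finset.sum_eq_single (τ j)]
  · by_cases h : i = σ (τ j)
    · simp [PM, h]
    · simp [PM, h]
  · intro b _ hb
    simp [PM, hb]
  · simp

lemma constCoeff_Q (σ : Perm α) : PowerSeries.constantCoeff (Q σ) = 1 := by
  unfold Q
  rw [RingHom.map_det]
  have : (PowerSeries.constantCoeff (R := ℝ)).mapMatrix (MM σ) = 1 := by
    ext i j
    simp [MM, Matrix.one_apply]
  rw [this, Matrix.det_one]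

lemma isUnit_Q (σ : Perm α) : IsUnit (Q σ) := by
  rw [PowerSeries.isUnit_iff_constantCoeff, constCoeff_Q]; exact isUnit_one

lemma NN_mul (σ : Perm α) : NN σ * MM σ = 1 := Matrix.nonsing_inv_mul _ (isUnit_Q σ)
lemma MM_mul (σ : Perm α) : MM σ * NN σ = 1 := Matrix.mul_nonsing_inv _ (isUnit_Q σ)

lemma NN_right (σ : Perm α) (x y : α) :
    NN σ x y = PowerSeries.X * NN σ x (σ y) + if x = y then 1 else 0 := by
  have h0 := NN_mul σ
  rw [MM, mul_sub, mul_one, Matrix.mul_smul] at h0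
  have h := congrFun (congrFun h0 x) y
  rw [Matrix.sub_apply, Matrix.smul_apply, Matrix.mul_apply, Finset.sum_eq_single (σ y),
    Matrix.one_apply] at h
  rotate_left
  · intro b _ hb
    simp [PM, hb]
  · simp
  simp only [PM, if_true, mul_one, smul_eq_mul] at h
  rw [← h]; ring

lemma NN_left (σ : Perm α) (x y : α) :
    NN σ (σ x) y = PowerSeries.X * NN σ x y + if σ x = y then 1 else 0 := by
  have h0 := MM_mul σ
  rw [MM, sub_mul, one_mul, Matrix.smul_mul] at h0
  have h := congrFun (congrFun h0 (σ x)) y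
  rw [Matrix.sub_apply, Matrix.smul_apply, Matrix.mul_apply, Finset.sum_eq_single x,
    Matrix.one_apply] at h
  rotate_left
  · intro b _ hb
    simp [PM, hb.symm]
  · simp
  simp only [PM, if_true, one_mul, smul_eq_mul] at h
  rw [← h]; ring

/-- rank one update -/
lemma Q_swap (σ : Perm α) {x y : α} (hxy : x ≠ y) :
    Q (σ * swap x y) = Q σ * (NN σ x x + NN σ y y - NN σ x y - NN σ y x - 1) := by
  classical
  set v : α → ℝ⟦X⟧ := Pi.single x 1 - Pi.single y 1 with hv
  have h1 : PM (swap x y) = 1 - Matrix.vecMulVec v v := by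
    ext i j : 2
    simp only [PM, Matrix.sub_apply, Matrix.one_apply, Matrix.vecMulVec_apply, hv, Pi.sub_apply,
      Pi.single_apply, swap_apply_def]
    split_ifs <;> simp_all
  have h2 : MM (σ * swap x y) = MM σ * (1 + Matrix.vecMulVec ((NN σ - 1).mulVec v) v) := by
    have : (PowerSeries.X : ℝ⟦X⟧) • PM σ = 1 - MM σ := by simp [MM]
    have e : MM (σ * swap x y) = 1 - ((PowerSeries.X : ℝ⟦X⟧) • PM σ) * PM (swap x y) := by
      rw [MM, PM_mul, Matrix.smul_mul]
    rw [e, this, h1, mul_add, Matrix.mul_vecMulVec, Matrix.mulVec_mulVec, mul_sub (MM σ), MM_mul,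
      Matrix.mul_sub, Matrix.mul_vecMulVec]
    rw [mul_one, mul_one]
    abel
  have h3 : v ⬝ᵥ (NN σ - 1).mulVec v = NN σ x x + NN σ y y - NN σ x y - NN σ y x - 2 := by
    rw [Matrix.sub_mulVec, Matrix.one_mulVec, hv, Matrix.mulVec_sub]
    simp [hxy, hxy.symm, sub_dotProduct]
    ring
  unfold Q
  rw [h2, Matrix.det_mul, Matrix.vecMulVec_eq Unit, Matrix.det_one_add_replicateCol_mul_replicateRow,
    h3]
  ring

lemma deriv_prod {ι : Type*} [DecidableEq ι] (s : Finset ι) (f : ι → ℝ⟦X⟧) :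
    PowerSeries.derivative ℝ (∏ i ∈ s, f i) =
      ∑ i ∈ s, (∏ j ∈ s.erase i, f j) * PowerSeries.derivative ℝ (f i) := by
  induction s using Finset.induction_on with
  | empty => simp
  | insert a s ha ih =>
    rw [Finset.prod_insert ha, Derivation.leibniz, Finset.sum_insert ha, Finset.erase_insert ha, ih,
      add_comm, smul_eq_mul, smul_eq_mul, Finset.mul_sum]
    congr 1
    refine Finset.sum_congr rfl fun i hi => ?_
    have hai : a ≠ i := fun h => ha (h ▸ hi)
    rw [Finset.erase_insert_of_ne hai, Finset.prod_insert (by simp [ha])]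
    ring

lemma deriv_det (M : Matrix α α ℝ⟦X⟧) :
    PowerSeries.derivative ℝ M.det = (M.adjugate * M.map (PowerSeries.derivative ℝ)).trace := by
  rw [Matrix.trace]
  simp only [Matrix.diag_apply, Matrix.mul_apply]
  have h : ∀ i, ∑ j, M.adjugate i j * (M.map (PowerSeries.derivative ℝ)) j i
      = (M.updateCol i fun j => PowerSeries.derivative ℝ (M j i)).det := by
    intro i
    rw [← Matrix.cramer_apply, Matrix.cramer_eq_adjugate_mulVec]
    simp [Matrix.mulVec, dotProduct]
  simp only [h, Matrix.det_apply]
  rw [map_sum, Finset.sum_comm]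
  refine Finset.sum_congr rfl fun σ _ => ?_
  rw [← Finset.smul_sum]
  rw [show ∀ z : ℝ⟦X⟧, (PowerSeries.derivative ℝ) (Perm.sign σ • z) =
    Perm.sign σ • (PowerSeries.derivative ℝ) z from fun z => by
      simp only [Units.smul_def]; rw [map_zsmul]]
  congr 1
  rw [deriv_prod]
  refine Finset.sum_congr rfl fun i _ => ?_
  rw [← Finset.mul_prod_erase univ _ (Finset.mem_univ i)]
  rw [Matrix.updateCol_self, mul_comm]
  congr 1
  refine Finset.prod_congr rfl fun j hj => ?_
  rw [Matrix.updateCol_ne (Finset.ne_of_mem_erase hj)]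

lemma deriv_Q (σ : Perm α) :
    PowerSeries.X * PowerSeries.derivative ℝ (Q σ) =
      Q σ * (((Fintype.card α : ℕ) : ℝ⟦X⟧) - ∑ x, NN σ x x) := by
  have hadj : (MM σ).adjugate = Q σ • NN σ := by
    have hu := isUnit_Q σ
    unfold Q at hu ⊢
    rw [NN, Matrix.inv_def, smul_smul, Ring.mul_inverse_cancel _ hu, one_smul]
  have hd : (MM σ).map (PowerSeries.derivative ℝ) = - PM σ := by
    ext i j : 2
    simp only [MM, Matrix.map_apply, Matrix.sub_apply, Matrix.smul_apply, PM, Matrix.one_apply,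
      Matrix.neg_apply, map_sub, smul_eq_mul]
    split_ifs <;> simp
  have hX : (PowerSeries.X : ℝ⟦X⟧) • (NN σ * PM σ) = NN σ - 1 := by
    have := NN_mul σ
    rw [MM, mul_sub, mul_one, Matrix.mul_smul] at this
    rw [← this]; abel
  rw [Q, deriv_det, hadj, hd, ← smul_eq_mul, ← Matrix.trace_smul, Matrix.smul_mul, smul_comm,
    Matrix.mul_neg, smul_neg, hX, Matrix.trace_smul, Matrix.trace_neg, Matrix.trace_sub,
    Matrix.trace_one]
  simp [Matrix.trace, Q]

end matrixpart
end HookWalk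

open Finset Filter Real

namespace HookWalk
open scoped PowerSeries
open Equiv

section identities
variable {α : Type*} [Fintype α] [DecidableEq α]

/-- the geometric series -/
noncomputable def G : ℝ⟦X⟧ := PowerSeries.mk 1

lemma G_mul : G * (1 - PowerSeries.X) = 1 := PowerSeries.mk_one_mul_one_sub_eq_one ℝ

lemma one_sub_X_ne : (1 - PowerSeries.X : ℝ⟦X⟧) ≠ 0 := by
  intro h
  have := G_mul
  rw [h] at this
  simp at this

lemma X_mul_G : PowerSeries.X * G = G - 1 := by
  linear_combination -G_mul

lemma deriv_G : PowerSeries.derivative ℝ G = G * G := by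
  have h := congrArg (PowerSeries.derivative ℝ) G_mul
  rw [Derivation.leibniz] at h
  simp only [smul_eq_mul, map_sub, PowerSeries.derivative_X, Derivation.map_one_eq_zero] at h
  linear_combination G * h - (PowerSeries.derivative ℝ G) * G_mul

lemma NN_fix_diag (σ : Perm α) {x : α} (hx : σ x = x) : NN σ x x = G := by
  have h := NN_right σ x x
  rw [hx, if_pos rfl] at h
  linear_combination G * h - NN σ x x * G_mul

lemma NN_fix_row (σ : Perm α) {x y : α} (hx : σ x = x) (hxy : x ≠ y) : NN σ x y = 0 := by
  have h := NN_left σ x y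
  rw [hx, if_neg hxy] at h
  linear_combination G * h - NN σ x y * G_mul

lemma NN_fix_col (σ : Perm α) {x y : α} (hx : σ x = x) (hxy : x ≠ y) : NN σ y x = 0 := by
  have h := NN_right σ y x
  rw [hx, if_neg hxy.symm] at h
  linear_combination G * h - NN σ y x * G_mul

lemma NN_row_sum (σ : Perm α) (x : α) : ∑ y, NN σ x y = G := by
  have h : ∑ y, NN σ x y = ∑ y, (PowerSeries.X * NN σ x (σ y) + if x = y then 1 else 0) :=
    Finset.sum_congr rfl fun y _ => NN_right σ x y
  rw [Finset.sum_add_distrib, ← Finset.mul_sum, Equiv.sum_comp σ (fun z => NN σ x z)] at h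
  simp only [Finset.sum_ite_eq, Finset.mem_univ, if_true] at h
  linear_combination G * h - (∑ y, NN σ x y) * G_mul

lemma NN_row_sum_compl (σ : Perm α) (A : Finset α) (hA : ∀ x ∈ A, σ x = x) {x : α} (hx : x ∉ A) :
    ∑ y ∈ Aᶜ, NN σ x y = G := by
  rw [← NN_row_sum σ x, ← Finset.sum_compl_add_sum A]
  rw [Finset.sum_eq_zero (s := A), add_zero]
  intro y hy
  exact NN_fix_col σ (hA y hy) (fun h => hx (h ▸ hy))

/-- the hook generating function -/
noncomputable def RR (a : ℕ) (σ : Perm α) : ℝ⟦X⟧ := Q σ * G ^ (a + 1)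

noncomputable def uu (a j : ℕ) (σ : Perm α) : ℝ := PowerSeries.coeff j (RR a σ)

lemma diag_sum (σ : Perm α) (A : Finset α) (hA : ∀ x ∈ A, σ x = x) :
    Q σ * (∑ x ∈ Aᶜ, NN σ x x) * G ^ (A.card + 1) =
      (((Aᶜ.card : ℕ) : ℝ⟦X⟧) - 1) * RR A.card σ + G * RR A.card σ
        - PowerSeries.X * PowerSeries.derivative ℝ (RR A.card σ) := by
  have h := deriv_Q σ
  rw [← Finset.sum_compl_add_sum A] at h
  have h2 : ∑ x ∈ A, NN σ x x = (A.card : ℝ⟦X⟧) * G := by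
    rw [Finset.sum_congr rfl fun x hx => NN_fix_diag σ (hA x hx)]
    simp
  have hc : ((Fintype.card α : ℕ) : ℝ⟦X⟧) = ((Aᶜ.card : ℕ) : ℝ⟦X⟧) + (A.card : ℝ⟦X⟧) := by
    rw [← Nat.cast_add, Finset.card_compl_add_card]
  rw [h2, hc] at h
  have hd : PowerSeries.derivative ℝ (RR A.card σ) =
      PowerSeries.derivative ℝ (Q σ) * G ^ (A.card + 1) +
        ((A.card : ℝ⟦X⟧) + 1) * Q σ * G ^ (A.card + 2) := by
    rw [RR, Derivation.leibniz, PowerSeries.derivative_pow, deriv_G]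
    simp only [smul_eq_mul, Nat.add_sub_cancel]
    push_cast
    ring
  rw [hd, RR]
  have hx := X_mul_G
  linear_combination (G ^ (A.card + 1)) * h + ((A.card : ℝ⟦X⟧) + 1) * Q σ * G ^ (A.card + 1) * hx

lemma sum_swap_inside (σ : Perm α) (A : Finset α) (hA : ∀ x ∈ A, σ x = x) :
    ∑ p ∈ Aᶜ.offDiag, RR A.card (σ * swap p.1 p.2) =
      ((Aᶜ.card : ℕ) : ℝ⟦X⟧) * (((Aᶜ.card : ℕ) : ℝ⟦X⟧) - 1) * RR A.card σ
        - 2 * ((Aᶜ.card : ℕ) : ℝ⟦X⟧) * (PowerSeries.X * PowerSeries.derivative ℝ (RR A.card σ)) := by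
  have e : ∀ p ∈ Aᶜ.offDiag, RR A.card (σ * swap p.1 p.2) =
      RR A.card σ * (NN σ p.1 p.1 + NN σ p.2 p.2 - NN σ p.1 p.2 - NN σ p.2 p.1 - 1) := by
    intro p hp
    rw [Finset.mem_offDiag] at hp
    rw [RR, Q_swap σ hp.2.2, RR]; ring
  rw [Finset.sum_congr rfl e, ← Finset.mul_sum]
  have hdiag : ∑ p ∈ Aᶜ.diag, (NN σ p.1 p.1 + NN σ p.2 p.2 - NN σ p.1 p.2 - NN σ p.2 p.1 - 1) =
      -((Aᶜ.card : ℕ) : ℝ⟦X⟧) := by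
    rw [Finset.sum_congr rfl (g := fun _ => (-1 : ℝ⟦X⟧))]
    · simp [Finset.diag_card]
    · intro p hp
      rw [Finset.mem_diag] at hp
      rw [hp.2]; ring
  have hall := Finset.sum_union (Finset.disjoint_diag_offDiag (Aᶜ))
    (f := fun p : α × α => (NN σ p.1 p.1 + NN σ p.2 p.2 - NN σ p.1 p.2 - NN σ p.2 p.1 - 1))
  rw [Finset.diag_union_offDiag, hdiag, Finset.sum_product] at hall
  generalize ∑ p ∈ Aᶜ.offDiag,
    (NN σ p.1 p.1 + NN σ p.2 p.2 - NN σ p.1 p.2 - NN σ p.2 p.1 - 1) = OD at hall ⊢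
  simp only [Finset.sum_sub_distrib, Finset.sum_add_distrib, Finset.sum_const, nsmul_eq_mul,
    mul_one] at hall
  have r1 : ∑ x ∈ Aᶜ, ∑ y ∈ Aᶜ, NN σ x y = ((Aᶜ.card : ℕ) : ℝ⟦X⟧) * G := by
    rw [Finset.sum_congr rfl fun x hx => NN_row_sum_compl σ A hA (Finset.mem_compl.1 hx)]
    simp
  have r2 : ∑ x ∈ Aᶜ, ∑ y ∈ Aᶜ, NN σ y x = ((Aᶜ.card : ℕ) : ℝ⟦X⟧) * G := by
    rw [Finset.sum_comm, r1]
  rw [r1, r2, ← Finset.mul_sum] at hall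
  have hD := diag_sum σ A hA
  have hR : RR A.card σ = Q σ * G ^ (A.card + 1) := rfl
  rw [hR] at hD ⊢
  linear_combination (-(Q σ * G ^ (A.card + 1))) * hall + 2 * ((Aᶜ.card : ℕ) : ℝ⟦X⟧) * hD

lemma Q_removal (σ : Perm α) {x : α} (hx : σ x ≠ x) :
    PowerSeries.X * Q (σ * swap x (σ⁻¹ x)) =
      Q σ * (1 - PowerSeries.X) * (1 - (1 - PowerSeries.X) * NN σ x x) := by
  set y := σ⁻¹ x with hy
  have hs : σ y = x := by simp [hy]
  have hxy : x ≠ y := by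
    intro h
    apply hx
    rw [← h] at hs
    exact hs
  have h1 := NN_right σ x y
  have h2 := NN_left σ y y
  have h3 := NN_left σ y x
  rw [hs, if_neg hxy] at h1 h2
  rw [hs, if_pos rfl] at h3
  have h4 : NN σ y y = NN σ x x := by
    apply mul_left_cancel₀ (PowerSeries.X_ne_zero (R := ℝ))
    linear_combination h1 - h2
  rw [Q_swap σ hxy, h4, h1]
  linear_combination (Q σ) * h3

lemma sum_removal (σ : Perm α) (A : Finset α) (hA : ∀ x ∈ A, σ x = x) :
    ∑ x ∈ Aᶜ.filter (fun x => σ x ≠ x), RR (A.card + 1) (σ * swap x (σ⁻¹ x)) =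
      (((Aᶜ.card : ℕ) : ℝ⟦X⟧) - 1) * RR A.card σ
        + (1 - PowerSeries.X) * PowerSeries.derivative ℝ (RR A.card σ) := by
  apply mul_left_cancel₀ (PowerSeries.X_ne_zero (R := ℝ))
  rw [Finset.mul_sum]
  have e : ∀ x ∈ Aᶜ.filter (fun x => σ x ≠ x),
      PowerSeries.X * RR (A.card + 1) (σ * swap x (σ⁻¹ x)) =
      RR A.card σ * (1 - (1 - PowerSeries.X) * NN σ x x) := by
    intro x hx
    rw [Finset.mem_filter] at hx
    have h := Q_removal σ hx.2
    have hg := G_mul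
    rw [RR, RR]
    linear_combination G ^ (A.card + 2) * h +
      (Q σ * G ^ (A.card + 1) * (1 - (1 - PowerSeries.X) * NN σ x x)) * hg
  rw [Finset.sum_congr rfl e, Finset.sum_filter_of_ne]
  · have hD := diag_sum σ A hA
    have hg := G_mul
    rw [← Finset.mul_sum, Finset.sum_sub_distrib, ← Finset.mul_sum]
    simp only [Finset.sum_const, nsmul_eq_mul, mul_one]
    have hR : RR A.card σ = Q σ * G ^ (A.card + 1) := rfl
    rw [hR] at hD ⊢
    linear_combination (-(1 - PowerSeries.X)) * hD - (Q σ * G ^ (A.card + 1)) * hg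
  · intro x _ hne hfix
    apply hne
    rw [NN_fix_diag σ hfix, mul_comm _ G, G_mul]; simp

lemma coeff_X_deriv (f : ℝ⟦X⟧) (j : ℕ) :
    PowerSeries.coeff j (PowerSeries.X * PowerSeries.derivative ℝ f) = j * PowerSeries.coeff j f := by
  cases j with
  | zero => simp
  | succ j =>
    rw [PowerSeries.coeff_succ_X_mul, PowerSeries.coeff_derivative]
    push_cast; ring

lemma coeff_nat_mul (c : ℕ) (f : ℝ⟦X⟧) (j : ℕ) :
    PowerSeries.coeff j ((c : ℝ⟦X⟧) * f) = c * PowerSeries.coeff j f := by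
  rw [← nsmul_eq_mul, map_nsmul, nsmul_eq_mul]

lemma uu_inside (σ : Perm α) (A : Finset α) (hA : ∀ x ∈ A, σ x = x) (j : ℕ) :
    ∑ p ∈ Aᶜ.offDiag, uu A.card j (σ * swap p.1 p.2) =
      ((Aᶜ.card : ℝ) * ((Aᶜ.card : ℝ) - 1) - 2 * Aᶜ.card * j) * uu A.card j σ := by
  unfold uu
  rw [← map_sum, sum_swap_inside σ A hA]
  have : ∀ (c : ℕ) (f g : ℝ⟦X⟧), (c : ℝ⟦X⟧) * ((c : ℝ⟦X⟧) - 1) * f - 2 * (c : ℝ⟦X⟧) * g =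
    (c : ℝ⟦X⟧) * ((c : ℝ⟦X⟧) * f) - (c : ℝ⟦X⟧) * f - ((2 : ℕ) : ℝ⟦X⟧) * ((c : ℝ⟦X⟧) * g) := by
      intros; push_cast; ring
  rw [this, map_sub, map_sub]
  simp only [coeff_nat_mul, coeff_X_deriv]
  push_cast; ring

lemma uu_removal (σ : Perm α) (A : Finset α) (hA : ∀ x ∈ A, σ x = x) (j : ℕ) :
    ∑ x ∈ Aᶜ.filter (fun x => σ x ≠ x), uu (A.card + 1) j (σ * swap x (σ⁻¹ x)) =
      ((Aᶜ.card : ℝ) - 1 - j) * uu A.card j σ + (j + 1) * uu A.card (j + 1) σ := by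
  unfold uu
  rw [← map_sum, sum_removal σ A hA]
  rw [sub_mul, one_mul, sub_mul, one_mul, map_add, map_sub, map_sub]
  simp only [coeff_nat_mul, coeff_X_deriv, PowerSeries.coeff_derivative]
  ring

end identities
end HookWalk

open Finset Filter Real

namespace HookWalk
open scoped PowerSeries
open Equiv

section product
variable {α : Type*} [Fintype α] [DecidableEq α]

lemma Q_disjoint {σ ρ : Perm α} (h : Perm.Disjoint σ ρ) :
    Q σ * Q ρ = (1 - PowerSeries.X) ^ (Fintype.card α) * Q (σ * ρ) := by
  have h1 : PM σ + PM ρ = 1 + PM (σ * ρ) := by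
    refine Matrix.ext fun i j => ?_
    rw [Matrix.add_apply, Matrix.add_apply, Matrix.one_apply]
    unfold PM
    rcases h j with hj | hj
    · have h2 : (σ * ρ) j = ρ j := by
        rw [Perm.mul_apply]
        rcases h (ρ j) with h3 | h3
        · exact h3
        · rw [ρ.injective h3, hj]
      rw [hj, h2]
    · have h2 : (σ * ρ) j = σ j := by rw [Perm.mul_apply, hj]
      rw [hj, h2, add_comm]
  have h2 : MM σ * MM ρ = (1 - PowerSeries.X : ℝ⟦X⟧) • MM (σ * ρ) := by
    have e : PM ρ = 1 + PM (σ * ρ) - PM σ := by rw [← h1]; abel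
    simp only [MM]
    rw [sub_mul, one_mul, mul_sub, mul_one, Matrix.smul_mul, Matrix.mul_smul, ← PM_mul, e]
    simp only [sub_smul, smul_sub, smul_add, one_smul]
    abel
  unfold Q
  rw [← Matrix.det_mul, h2, Matrix.det_smul]

lemma Q_one : Q (1 : Perm α) = (1 - PowerSeries.X) ^ (Fintype.card α) := by
  have : MM (1 : Perm α) = (1 - PowerSeries.X : ℝ⟦X⟧) • 1 := by
    have : PM (1 : Perm α) = 1 := by
      refine Matrix.ext fun i j => ?_
      rw [Matrix.one_apply]
      rfl
    rw [MM, this, sub_smul, one_smul]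
  rw [Q, this, Matrix.det_smul, Matrix.det_one, mul_one]

lemma NN_pow (σ : Perm α) (x : α) (l : ℕ) (hl : ∀ i, 0 < i → i < l → (σ ^ i) x ≠ x) :
    ∀ i, 0 < i → i ≤ l → NN σ x x = PowerSeries.X ^ i * NN σ x ((σ ^ i) x) + 1 := by
  intro i hi
  induction i, hi using Nat.le_induction with
  | base =>
    intro _
    have h := NN_right σ x x
    rw [if_pos rfl] at h
    simpa using h
  | succ i hi ih =>
    intro hl'
    have h := NN_right σ x ((σ ^ i) x)
    rw [if_neg (hl i hi hl').symm] at h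
    rw [ih (by omega), h, pow_succ' σ, Perm.mul_apply]
    ring

lemma NN_cycle {σ : Perm α} (hσ : σ.IsCycle) {x : α} (hx : σ x ≠ x) :
    NN σ x x * (1 - PowerSeries.X ^ σ.support.card) = 1 := by
  have hpos : 0 < σ.support.card := by
    rw [Finset.card_pos]; exact ⟨x, Perm.mem_support.2 hx⟩
  have h := NN_pow σ x σ.support.card (by
    intro i hi hil h
    have h1 : σ ^ i = 1 := by
      rw [hσ.pow_eq_one_iff]; exact ⟨x, hx, h⟩
    have := orderOf_dvd_of_pow_eq_one h1
    rw [hσ.orderOf] at this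
    exact absurd (Nat.le_of_dvd hi this) (by omega)) _ hpos le_rfl
  have h1 : σ ^ σ.support.card = 1 := by rw [← hσ.orderOf]; exact pow_orderOf_eq_one σ
  rw [h1, Perm.one_apply] at h
  linear_combination h

lemma Q_cycle {σ : Perm α} (hσ : σ.IsCycle) :
    Q σ = (1 - PowerSeries.X) ^ (Fintype.card α - σ.support.card) *
      (1 - PowerSeries.X ^ σ.support.card) := by
  set l := σ.support.card with hl
  set d := Fintype.card α - l with hd
  have hl0 : 0 < l := by
    have := hσ.two_le_card_support
    omega
  have hdl : Fintype.card α = d + l := by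
    have : l ≤ Fintype.card α := Finset.card_le_univ _
    omega
  set F : ℝ⟦X⟧ := (1 - PowerSeries.X) ^ d * (1 - PowerSeries.X ^ l) with hF
  have hFc : PowerSeries.constantCoeff F = 1 := by
    simp [hF, hl0.ne']
  have hF0 : F * F⁻¹ = 1 := PowerSeries.mul_inv_cancel F (by rw [hFc]; exact one_ne_zero)
  obtain ⟨x0, hx0⟩ : ∃ x, σ x ≠ x := hσ.nonempty_support.imp fun x hx => Perm.mem_support.1 hx
  set K := NN σ x0 x0 with hK
  have hK1 : K * (1 - PowerSeries.X ^ l) = 1 := NN_cycle hσ hx0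
  have hsum : ∑ x, NN σ x x = (d : ℝ⟦X⟧) * G + (l : ℝ⟦X⟧) * K := by
    rw [← Finset.sum_compl_add_sum σ.support]
    congr 1
    · rw [Finset.sum_congr rfl fun x hx => NN_fix_diag σ (by
        rw [Finset.mem_compl, Perm.notMem_support] at hx; exact hx)]
      rw [Finset.sum_const, nsmul_eq_mul, Finset.card_compl]
    · rw [Finset.sum_congr rfl (g := fun _ => K)]
      · rw [Finset.sum_const, nsmul_eq_mul]
      · intro x hx
        have h := NN_cycle hσ (Perm.mem_support.1 hx)
        linear_combination K * h - NN σ x x * hK1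
  have hQ := deriv_Q σ
  rw [hsum, hdl] at hQ
  have hF' : PowerSeries.X * PowerSeries.derivative ℝ F =
      F * (((d + l : ℕ) : ℝ⟦X⟧) - ((d : ℝ⟦X⟧) * G + (l : ℝ⟦X⟧) * K)) := by
    have e1 : PowerSeries.derivative ℝ ((1 - PowerSeries.X : ℝ⟦X⟧) ^ d) =
        - (d : ℝ⟦X⟧) * G * (1 - PowerSeries.X) ^ d := by
      rw [PowerSeries.derivative_pow]
      simp only [map_sub, PowerSeries.derivative_X, Derivation.map_one_eq_zero]
      rcases Nat.eq_zero_or_pos d with h0 | h0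
      · simp [h0]
      · obtain ⟨e, he⟩ : ∃ e, d = e + 1 := ⟨d - 1, by omega⟩
        rw [he, Nat.add_sub_cancel]
        have hg := G_mul
        linear_combination (((e + 1 : ℕ) : ℝ⟦X⟧) * (1 - PowerSeries.X) ^ e) * hg
    have e2 : PowerSeries.X * PowerSeries.derivative ℝ (1 - PowerSeries.X ^ l : ℝ⟦X⟧) =
        - (l : ℝ⟦X⟧) * PowerSeries.X ^ l := by
      rw [map_sub, PowerSeries.derivative_pow]
      simp only [PowerSeries.derivative_X, Derivation.map_one_eq_zero]
      obtain ⟨e, he⟩ : ∃ e, l = e + 1 := ⟨l - 1, by omega⟩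
      rw [he, Nat.add_sub_cancel]
      ring
    rw [hF, Derivation.leibniz, e1]
    simp only [smul_eq_mul]
    have hx := X_mul_G
    push_cast
    linear_combination ((1 - PowerSeries.X) ^ d) * e2
      - (1 - PowerSeries.X ^ l) * (d : ℝ⟦X⟧) * (1 - PowerSeries.X) ^ d * hx
      + (1 - PowerSeries.X) ^ d * (l : ℝ⟦X⟧) * hK1
  have hder : PowerSeries.derivative ℝ (Q σ * F⁻¹) = 0 := by
    apply mul_left_cancel₀ (PowerSeries.X_ne_zero (R := ℝ))
    rw [Derivation.leibniz, PowerSeries.derivative_inv']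
    simp only [smul_eq_mul]
    linear_combination F⁻¹ * hQ - Q σ * F⁻¹ ^ 2 * hF' -
      (Q σ * F⁻¹ * (((d + l : ℕ) : ℝ⟦X⟧) - ((d : ℝ⟦X⟧) * G + (l : ℝ⟦X⟧) * K))) * hF0
  have hone : Q σ * F⁻¹ = 1 := by
    apply PowerSeries.derivative.ext
    · rw [hder, Derivation.map_one_eq_zero]
    · rw [map_mul, constCoeff_Q, PowerSeries.constantCoeff_inv, hFc]; simp
  linear_combination F * hone - Q σ * hF0

lemma Q_formula (σ : Perm α) : Q σ * (1 - PowerSeries.X) ^ σ.cycleType.sum =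
    (1 - PowerSeries.X) ^ (Fintype.card α) *
      (σ.cycleType.map (fun l => (1 - PowerSeries.X ^ l : ℝ⟦X⟧))).prod := by
  induction σ using Perm.cycle_induction_on with
  | base_one => simp [Q_one]
  | base_cycles σ hσ =>
    rw [hσ.cycleType, Q_cycle hσ]
    simp only [Multiset.sum_singleton, Multiset.map_singleton, Multiset.prod_singleton]
    have : σ.support.card ≤ Fintype.card α := Finset.card_le_univ _
    rw [mul_right_comm, ← pow_add, Nat.sub_add_cancel this]
  | induction_disjoint σ τ hd hc h1 h2 =>
    rw [hd.cycleType_mul, Multiset.sum_add, Multiset.map_add, Multiset.prod_add]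
    apply mul_left_cancel₀ (pow_ne_zero (Fintype.card α) one_sub_X_ne)
    have h3 := Q_disjoint hd
    rw [pow_add]
    generalize (1 - PowerSeries.X : ℝ⟦X⟧) ^ Fintype.card α = c1 at *
    generalize (1 - PowerSeries.X : ℝ⟦X⟧) ^ σ.cycleType.sum = c2 at *
    generalize (1 - PowerSeries.X : ℝ⟦X⟧) ^ τ.cycleType.sum = c3 at *
    linear_combination (-(c2 * c3)) * h3 + Q τ * c3 * h1 +
      c1 * (Multiset.map (fun l => (1 - PowerSeries.X ^ l : ℝ⟦X⟧)) σ.cycleType).prod * h2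

open Polynomial in
/-- explicit polynomial form of the hook generating function -/
noncomputable def hookPoly (z : ℕ) (ct : Multiset ℕ) : Polynomial ℝ :=
  (1 - Polynomial.X) ^ (z + ct.card - 1) *
    (ct.map (fun l => ∑ i ∈ Finset.range l, (Polynomial.X : Polynomial ℝ) ^ i)).prod

lemma prod_geom (ct : Multiset ℕ) :
    (ct.map (fun l => (1 - PowerSeries.X ^ l : ℝ⟦X⟧))).prod = (1 - PowerSeries.X) ^ ct.card *
      (((ct.map (fun l => ∑ i ∈ Finset.range l, (Polynomial.X : Polynomial ℝ) ^ i)).prod :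
        Polynomial ℝ) : ℝ⟦X⟧) := by
  induction ct using Multiset.induction_on with
  | empty => simp
  | cons l ct ih =>
    simp only [Multiset.map_cons, Multiset.prod_cons, Multiset.card_cons, Polynomial.coe_mul, ih]
    have h : (1 - PowerSeries.X ^ l : ℝ⟦X⟧) = (1 - PowerSeries.X) *
        ((∑ i ∈ Finset.range l, (Polynomial.X : Polynomial ℝ) ^ i : Polynomial ℝ) : ℝ⟦X⟧) := by
      have := mul_neg_geom_sum (Polynomial.X : Polynomial ℝ) l
      have h2 := congrArg (fun p : Polynomial ℝ => (p : ℝ⟦X⟧)) this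
      simp only [Polynomial.coe_mul, Polynomial.coe_sub, Polynomial.coe_one, Polynomial.coe_X,
        Polynomial.coe_pow] at h2
      exact h2.symm
    rw [h]; ring

lemma RR_poly (σ : Perm α) (A : Finset α) (hA : ∀ x ∈ A, σ x = x) (hm : 1 ≤ Aᶜ.card) :
    RR A.card σ = (hookPoly (Aᶜ.card - σ.cycleType.sum) σ.cycleType : ℝ⟦X⟧) := by
  have hs : σ.cycleType.sum ≤ Aᶜ.card := by
    rw [Perm.sum_cycleType]
    apply Finset.card_le_card
    intro x hx
    rw [Finset.mem_compl]
    intro h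
    exact Perm.mem_support.1 hx (hA x h)
  have hc : Fintype.card α = Aᶜ.card + A.card := by rw [Finset.card_compl_add_card]
  have hf := Q_formula σ
  rw [prod_geom, hc] at hf
  have hcpos : 1 ≤ (Aᶜ.card - σ.cycleType.sum) + σ.cycleType.card := by
    by_contra h
    have h1 : σ.cycleType.card = 0 := by omega
    rw [Multiset.card_eq_zero] at h1
    rw [h1] at h
    simp at h
    rw [h] at hm
    simp at hm
  obtain ⟨z, hz⟩ : ∃ z, Aᶜ.card = z + σ.cycleType.sum := ⟨_, (Nat.sub_add_cancel hs).symm⟩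
  rw [hz, Nat.add_sub_cancel] at hcpos ⊢
  rw [hz] at hf
  obtain ⟨w, hw⟩ : ∃ w, z + σ.cycleType.card = w + 1 := ⟨_, (Nat.sub_add_cancel hcpos).symm⟩
  rw [hookPoly, hw, Nat.add_sub_cancel]
  simp only [Polynomial.coe_mul, Polynomial.coe_sub, Polynomial.coe_one, Polynomial.coe_X,
        Polynomial.coe_pow, RR]
  have hG : (G : ℝ⟦X⟧) ^ (A.card + 1) * (1 - PowerSeries.X) ^ (A.card + 1) = 1 := by
    rw [← mul_pow, G_mul, one_pow]
  apply mul_left_cancel₀ (pow_ne_zero (A.card + 1 + σ.cycleType.sum) one_sub_X_ne)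
  generalize (((σ.cycleType.map (fun l => ∑ i ∈ Finset.range l,
    (Polynomial.X : Polynomial ℝ) ^ i)).prod : Polynomial ℝ) : ℝ⟦X⟧) = p at *
  have e1 : (1 - PowerSeries.X : ℝ⟦X⟧) ^ (z + σ.cycleType.sum + A.card) *
    ((1 - PowerSeries.X) ^ σ.cycleType.card * p) =
      (1 - PowerSeries.X) ^ (A.card + 1 + σ.cycleType.sum) * ((1 - PowerSeries.X) ^ w * p) := by
    rw [← mul_assoc, ← mul_assoc, ← pow_add, ← pow_add]
    congr 2; omega
  rw [← e1, ← hf, pow_add]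
  linear_combination (Q σ * (1 - PowerSeries.X) ^ σ.cycleType.sum) * hG

lemma hookPoly_deg (z : ℕ) (ct : Multiset ℕ) (h0 : ∀ l ∈ ct, 1 ≤ l) (h1 : 1 ≤ z + ct.card) :
    (hookPoly z ct).natDegree = z + ct.sum - 1 ∧
      (hookPoly z ct).leadingCoeff = (-1) ^ (z + ct.card - 1) := by
  have hm : ∀ l ∈ ct, (∑ i ∈ Finset.range l, (Polynomial.X : Polynomial ℝ) ^ i).Monic :=
    fun l hl => Polynomial.monic_geom_sum_X (Nat.one_le_iff_ne_zero.1 (h0 l hl))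
  have hprod : (ct.map (fun l => ∑ i ∈ Finset.range l, (Polynomial.X : Polynomial ℝ) ^ i)).prod.Monic
      ∧ (ct.map (fun l => ∑ i ∈ Finset.range l, (Polynomial.X : Polynomial ℝ) ^ i)).prod.natDegree
        + ct.card = ct.sum := by
    clear h1
    induction ct using Multiset.induction_on with
    | empty => simp
    | cons l ct ih =>
      obtain ⟨i1, i2⟩ := ih (fun l hl => h0 l (Multiset.mem_cons_of_mem hl))
        (fun l hl => hm l (Multiset.mem_cons_of_mem hl))
      have hl := hm l (Multiset.mem_cons_self l ct)
      have hl1 := h0 l (Multiset.mem_cons_self l ct)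
      simp only [Multiset.map_cons, Multiset.prod_cons, Multiset.card_cons, Multiset.sum_cons]
      refine ⟨hl.mul i1, ?_⟩
      rw [hl.natDegree_mul i1]
      have : (∑ i ∈ Finset.range l, (Polynomial.X : Polynomial ℝ) ^ i).natDegree = l - 1 := by
        obtain ⟨e, rfl⟩ : ∃ e, l = e + 1 := ⟨l - 1, by omega⟩
        apply Polynomial.natDegree_eq_of_degree_eq_some
        rw [Finset.sum_range_succ, Polynomial.degree_add_eq_right_of_degree_lt]
        · simp
        · rw [Polynomial.degree_X_pow]
          refine (Polynomial.degree_sum_le _ _).trans_lt ?_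
          rw [Finset.sup_lt_iff (WithBot.bot_lt_coe _)]
          intro b hb
          rw [Polynomial.degree_X_pow]
          exact_mod_cast Finset.mem_range.1 hb
      omega
  have hX : (1 - Polynomial.X : Polynomial ℝ) = - (Polynomial.X - Polynomial.C 1) := by simp
  have hXd : (1 - Polynomial.X : Polynomial ℝ).natDegree = 1 := by
    rw [hX, Polynomial.natDegree_neg, Polynomial.natDegree_X_sub_C]
  have hXl : (1 - Polynomial.X : Polynomial ℝ).leadingCoeff = -1 := by
    rw [hX, Polynomial.leadingCoeff_neg, Polynomial.leadingCoeff_X_sub_C]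
  have hX0 : (1 - Polynomial.X : Polynomial ℝ) ≠ 0 := by
    intro h; rw [h] at hXd; simp at hXd
  constructor
  · rw [hookPoly, Polynomial.natDegree_mul (pow_ne_zero _ hX0) hprod.1.ne_zero,
      Polynomial.natDegree_pow, hXd]
    omega
  · rw [hookPoly, Polynomial.leadingCoeff_mul, Polynomial.leadingCoeff_pow, hXl, hprod.1]
    simp

end product
end HookWalk

open Finset Filter Real

namespace HookWalk
open scoped PowerSeries
open Equiv

section ortho
variable {α : Type*} [Fintype α] [DecidableEq α]

lemma uu_zero (a : ℕ) (σ : Perm α) : uu a 0 σ = 1 := by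
  rw [uu, RR, PowerSeries.coeff_zero_eq_constantCoeff_apply, map_mul, constCoeff_Q, map_pow]
  simp [G]

lemma sum_le_compl (σ : Perm α) (A : Finset α) (hA : ∀ x ∈ A, σ x = x) :
    σ.cycleType.sum ≤ Aᶜ.card := by
  rw [Perm.sum_cycleType]
  apply Finset.card_le_card
  intro x hx
  rw [Finset.mem_compl]
  intro h
  exact Perm.mem_support.1 hx (hA x h)

lemma one_le_zc (σ : Perm α) (A : Finset α) (hm : 1 ≤ Aᶜ.card) :
    1 ≤ (Aᶜ.card - σ.cycleType.sum) + σ.cycleType.card := by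
  by_contra h
  have h1 : σ.cycleType.card = 0 := by omega
  rw [Multiset.card_eq_zero] at h1
  rw [h1] at h
  simp at h
  rw [h] at hm
  simp at hm

lemma uu_top (σ : Perm α) (A : Finset α) (hA : ∀ x ∈ A, σ x = x) (hm : 1 ≤ Aᶜ.card) :
    uu A.card (Aᶜ.card - 1) σ = (-1) ^ (Aᶜ.card - 1) * ((Perm.sign σ : ℤ) : ℝ) := by
  have hs := sum_le_compl σ A hA
  have h1 := one_le_zc σ A hm
  obtain ⟨d1, d2⟩ := hookPoly_deg (Aᶜ.card - σ.cycleType.sum) σ.cycleType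
    (fun l hl => by have := Perm.two_le_of_mem_cycleType hl; omega) h1
  rw [Nat.sub_add_cancel hs] at d1
  rw [uu, RR_poly σ A hA hm, Polynomial.coeff_coe, ← d1]
  rw [Polynomial.coeff_natDegree, d2, d1, Perm.sign_of_cycleType]
  push_cast
  rw [← pow_add]
  obtain ⟨z, hz⟩ : ∃ z, Aᶜ.card = z + σ.cycleType.sum := ⟨_, (Nat.sub_add_cancel hs).symm⟩
  rw [hz, Nat.add_sub_cancel]
  rw [hz, Nat.add_sub_cancel] at h1
  rw [hz] at hm
  have : z + σ.cycleType.sum - 1 + (σ.cycleType.sum + σ.cycleType.card) =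
    (z + σ.cycleType.card - 1) + 2 * σ.cycleType.sum := by omega
  rw [this, pow_add, pow_mul]; simp

lemma uu_sum_eval (σ : Perm α) (A : Finset α) (hA : ∀ x ∈ A, σ x = x) (hm : 1 ≤ Aᶜ.card) :
    ∑ j ∈ range Aᶜ.card, uu A.card j σ =
      (hookPoly (Aᶜ.card - σ.cycleType.sum) σ.cycleType).eval 1 := by
  have hs := sum_le_compl σ A hA
  have h1 := one_le_zc σ A hm
  obtain ⟨d1, d2⟩ := hookPoly_deg (Aᶜ.card - σ.cycleType.sum) σ.cycleType
    (fun l hl => by have := Perm.two_le_of_mem_cycleType hl; omega) h1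
  rw [Nat.sub_add_cancel hs] at d1
  rw [Polynomial.eval_eq_sum_range' (n := Aᶜ.card) (by omega)]
  refine Finset.sum_congr rfl fun j _ => ?_
  rw [uu, RR_poly σ A hA hm, Polynomial.coeff_coe, one_pow, mul_one]

lemma hook_cycle {σ : Perm α} {A : Finset α} (hσ : σ.IsCycle) (hs : σ.support = Aᶜ) :
    hookPoly (Aᶜ.card - σ.cycleType.sum) σ.cycleType =
      ∑ i ∈ range Aᶜ.card, (Polynomial.X : Polynomial ℝ) ^ i := by
  rw [hσ.cycleType, ← hs, hookPoly]
  simp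

lemma fix_of_support {σ : Perm α} {A : Finset α} (hs : σ.support = Aᶜ) : ∀ x ∈ A, σ x = x := by
  intro x hx
  have : x ∉ σ.support := by rw [hs]; simpa using hx
  exact Perm.notMem_support.1 this

lemma uu_cycle {σ : Perm α} {A : Finset α} (hσ : σ.IsCycle) (hs : σ.support = Aᶜ) {j : ℕ}
    (hj : j < Aᶜ.card) : uu A.card j σ = 1 := by
  rw [uu, RR_poly σ A (fix_of_support hs) (by omega), hook_cycle hσ hs, Polynomial.coeff_coe,
    Polynomial.finsetSum_coeff]
  simp [Polynomial.coeff_X_pow, hj]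

open Classical in
lemma uu_sum (σ : Perm α) (A : Finset α) (hA : ∀ x ∈ A, σ x = x) (hm : 2 ≤ Aᶜ.card) :
    ∑ j ∈ range Aᶜ.card, uu A.card j σ =
      if σ.IsCycle ∧ σ.support = Aᶜ then (Aᶜ.card : ℝ) else 0 := by
  split_ifs with h
  · rw [Finset.sum_congr rfl fun j hj => uu_cycle h.1 h.2 (Finset.mem_range.1 hj)]
    simp
  · rw [uu_sum_eval σ A hA (by omega), hookPoly, Polynomial.eval_mul, Polynomial.eval_pow]
    have hs := sum_le_compl σ A hA
    have : (Aᶜ.card - σ.cycleType.sum) + σ.cycleType.card - 1 ≠ 0 := by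
      intro h0
      have h1 := one_le_zc σ A (by omega)
      have h2 : (Aᶜ.card - σ.cycleType.sum) + σ.cycleType.card = 1 := by omega
      rcases Nat.eq_zero_or_pos σ.cycleType.card with h3 | h3
      · have h4 := Multiset.card_eq_zero.1 h3
        rw [h4] at h2; simp at h2; omega
      · have h4 : σ.cycleType.card = 1 := by omega
        apply h
        refine ⟨Perm.card_cycleType_eq_one.1 h4, ?_⟩
        apply Finset.eq_of_subset_of_card_le
        · intro x hx
          rw [Finset.mem_compl]
          intro h
          exact Perm.mem_support.1 hx (hA x h)
        · rw [← Perm.sum_cycleType]; omega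
    simp [this]

/-- pointwise stabiliser -/
def HH (A : Finset α) : Finset (Perm α) := univ.filter fun σ => ∀ x ∈ A, σ x = x

lemma mem_HH {A : Finset α} {σ : Perm α} : σ ∈ HH A ↔ ∀ x ∈ A, σ x = x := by simp [HH]

lemma HH_card (A : Finset α) : (HH A).card = (Aᶜ.card).factorial := by
  have h := Fintype.card_congr (Perm.subtypeEquivSubtypePerm (fun x : α => x ∉ A))
  rw [Fintype.card_perm, Fintype.card_subtype, Fintype.card_subtype] at h
  have e1 : (univ.filter fun x => x ∉ A) = Aᶜ := by ext; simp
  rw [e1] at h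
  rw [h, HH]
  congr 1
  ext σ
  simp

lemma HH_swap {A : Finset α} {σ : Perm α} {p : α × α} (hp : p ∈ Aᶜ.offDiag) (hσ : σ ∈ HH A) :
    σ * swap p.1 p.2 ∈ HH A := by
  rw [mem_HH] at *
  intro x hx
  simp only [mem_offDiag, mem_compl] at hp
  rw [Perm.mul_apply, swap_apply_of_ne_of_ne, hσ x hx]
  · rintro rfl; exact hp.1 hx
  · rintro rfl; exact hp.2.1 hx

lemma selfadj (A : Finset α) (F K : Perm α → ℝ) :
    ∑ σ ∈ HH A, (∑ p ∈ Aᶜ.offDiag, F (σ * swap p.1 p.2)) * K σ =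
      ∑ σ ∈ HH A, F σ * (∑ p ∈ Aᶜ.offDiag, K (σ * swap p.1 p.2)) := by
  simp only [Finset.sum_mul, Finset.mul_sum]
  rw [Finset.sum_comm]
  conv_rhs => rw [Finset.sum_comm]
  refine Finset.sum_congr rfl fun p hp => ?_
  refine Finset.sum_bij' (fun σ _ => σ * swap p.1 p.2) (fun σ _ => σ * swap p.1 p.2)
    (fun σ h => HH_swap hp h) (fun σ h => HH_swap hp h) ?_ ?_ ?_
  · intro σ _; simp [mul_assoc]
  · intro σ _; simp [mul_assoc]
  · intro σ _; simp [mul_assoc]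

lemma uu_orth (A : Finset α) {i j : ℕ} (hij : i ≠ j) (hm : 1 ≤ Aᶜ.card) :
    ∑ σ ∈ HH A, uu A.card i σ * uu A.card j σ = 0 := by
  have h := selfadj A (uu A.card i) (uu A.card j)
  have h2 : (2 * (Aᶜ.card : ℝ) * ((j : ℝ) - i)) *
      ∑ σ ∈ HH A, uu A.card i σ * uu A.card j σ = 0 := by
    rw [Finset.mul_sum]
    rw [← sub_eq_zero, ← Finset.sum_sub_distrib] at h
    rw [← h]
    refine Finset.sum_congr rfl fun σ hσ => ?_
    rw [uu_inside σ A (mem_HH.1 hσ) i, uu_inside σ A (mem_HH.1 hσ) j]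
    ring
  rcases mul_eq_zero.1 h2 with h3 | h3
  · exfalso
    have h4 : (Aᶜ.card : ℝ) ≠ 0 := by
      have : (1 : ℝ) ≤ Aᶜ.card := by exact_mod_cast hm
      linarith
    have h5 : (j : ℝ) - i ≠ 0 := by
      rw [sub_ne_zero]; exact_mod_cast hij.symm
    exact (mul_ne_zero (mul_ne_zero two_ne_zero h4) h5) h3
  · exact h3

lemma uu_norm (A : Finset α) {j : ℕ} (hm : 2 ≤ Aᶜ.card) (hj : j < Aᶜ.card) :
    ∑ σ ∈ HH A, uu A.card j σ * uu A.card j σ = ((Aᶜ.card).factorial : ℝ) := by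
  classical
  have key : ∀ i, i < Aᶜ.card → ∑ σ ∈ HH A, uu A.card i σ * uu A.card i σ =
      ∑ σ ∈ HH A, ∑ l ∈ range Aᶜ.card, uu A.card l σ := by
    intro i hi
    have h1 : ∑ σ ∈ HH A, (∑ l ∈ range Aᶜ.card, uu A.card l σ) * uu A.card i σ =
        ∑ σ ∈ HH A, uu A.card i σ * uu A.card i σ := by
      simp only [Finset.sum_mul]
      rw [Finset.sum_comm, Finset.sum_eq_single i]
      · intro b _ hb
        exact uu_orth A hb (by omega)
      · intro h; exact absurd (Finset.mem_range.2 hi) h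
    rw [← h1]
    refine Finset.sum_congr rfl fun σ hσ => ?_
    rw [uu_sum σ A (mem_HH.1 hσ) hm]
    split_ifs with h
    · rw [uu_cycle h.1 h.2 hi, mul_one]
    · simp
  rw [key j hj, ← key 0 (by omega)]
  simp only [uu_zero, mul_one, Finset.sum_const, nsmul_eq_mul, HH_card]

lemma count_cycles (A : Finset α) (hm : 2 ≤ Aᶜ.card) :
    ∑ σ ∈ HH A, ∑ l ∈ range Aᶜ.card, uu A.card l σ = ((Aᶜ.card).factorial : ℝ) := by
  rw [Finset.sum_comm, Finset.sum_eq_single 0]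
  · simp only [uu_zero, Finset.sum_const, nsmul_eq_mul, HH_card, mul_one]
  · intro b _ hb
    have := uu_orth A hb (j := 0) (by omega)
    simpa [uu_zero] using this
  · intro h; exact absurd (Finset.mem_range.2 (by omega)) h

lemma uu_L2 (A : Finset α) (hm : 2 ≤ Aᶜ.card) (J : Finset ℕ) (hJ : J ⊆ range Aᶜ.card)
    (c : ℕ → ℝ) :
    ∑ σ ∈ HH A, (∑ j ∈ J, c j * uu A.card j σ) ^ 2 = (Aᶜ.card).factorial * ∑ j ∈ J, c j ^ 2 := by
  have : ∀ σ : Perm α, (∑ j ∈ J, c j * uu A.card j σ) ^ 2 =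
      ∑ i ∈ J, ∑ j ∈ J, c i * c j * (uu A.card i σ * uu A.card j σ) := by
    intro σ
    rw [sq, Finset.sum_mul_sum]
    refine Finset.sum_congr rfl fun i _ => Finset.sum_congr rfl fun j _ => by ring
  simp only [this]
  rw [Finset.sum_comm, Finset.mul_sum]
  refine Finset.sum_congr rfl fun i hi => ?_
  rw [Finset.sum_comm, Finset.sum_eq_single i]
  · rw [← Finset.mul_sum, uu_norm A hm (Finset.mem_range.1 (hJ hi))]; ring
  · intro b _ hb
    rw [← Finset.mul_sum, uu_orth A hb.symm (by omega), mul_zero]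
  · intro h; exact absurd hi h

/-- negative part bound -/
lemma uu_neg_part (A : Finset α) (hm : 2 ≤ Aᶜ.card) (J : Finset ℕ) (hJ : J ⊆ range Aᶜ.card)
    (h0 : 0 ∉ J) (c : ℕ → ℝ) :
    ∑ σ ∈ HH A, max (-(∑ j ∈ J, c j * uu A.card j σ)) 0 ≤
      1 / 2 * (Aᶜ.card).factorial * √(∑ j ∈ J, c j ^ 2) := by
  set g : Perm α → ℝ := fun σ => ∑ j ∈ J, c j * uu A.card j σ with hg
  have hmean : ∑ σ ∈ HH A, g σ = 0 := by
    simp only [hg]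
    rw [Finset.sum_comm]
    refine Finset.sum_eq_zero fun j hj => ?_
    rw [← Finset.mul_sum]
    have hj0 : j ≠ 0 := fun h => h0 (h ▸ hj)
    have := uu_orth A hj0 (by omega)
    simp only [uu_zero, mul_one] at this
    rw [this, mul_zero]
  have habs : ∑ σ ∈ HH A, |g σ| ≤ (Aᶜ.card).factorial * √(∑ j ∈ J, c j ^ 2) := by
    have hcs := Finset.sum_mul_sq_le_sq_mul_sq (HH A) (fun σ => |g σ|) (fun _ => (1 : ℝ))
    simp only [mul_one, sq_abs, one_pow, Finset.sum_const, nsmul_eq_mul, HH_card] at hcs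
    rw [uu_L2 A hm J hJ c] at hcs
    rw [← Real.sqrt_sq (Finset.sum_nonneg fun σ _ => abs_nonneg (g σ))]
    have : ((Aᶜ.card).factorial : ℝ) * √(∑ j ∈ J, c j ^ 2) =
        √((Aᶜ.card).factorial * (∑ j ∈ J, c j ^ 2) * (Aᶜ.card).factorial) := by
      rw [mul_right_comm, ← sq, Real.sqrt_mul (by positivity), Real.sqrt_sq (by positivity)]
    rw [this]
    exact Real.sqrt_le_sqrt hcs
  have hmax : ∀ σ, max (-(g σ)) 0 = 1 / 2 * (|g σ| - g σ) := by
    intro σ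
    rcases le_total (g σ) 0 with h | h
    · rw [abs_of_nonpos h, max_eq_left (by linarith)]; ring
    · rw [abs_of_nonneg h, max_eq_right (by linarith)]; ring
  calc ∑ σ ∈ HH A, max (-(g σ)) 0 = 1 / 2 * ∑ σ ∈ HH A, |g σ| := by
        simp only [hmax]
        rw [← Finset.mul_sum, Finset.sum_sub_distrib, hmean, sub_zero]
    _ ≤ _ := by rw [mul_assoc]; linarith

end ortho
end HookWalk

open Finset Filter Real

namespace HookWalk
open scoped PowerSeries
open Equiv

section chain

lemma swap_eq_iff {α : Type*} [DecidableEq α] {a b x y : α} (hab : a ≠ b) (h : swap a b = swap x y) :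
    (a = x ∧ b = y) ∨ (a = y ∧ b = x) := by
  have h1 : swap x y a = b := by rw [← h, swap_apply_left]
  by_cases hax : a = x
  · left; refine ⟨hax, ?_⟩
    rw [hax, swap_apply_left] at h1; exact h1.symm
  · by_cases hay : a = y
    · right; refine ⟨hay, ?_⟩
      rw [hay, swap_apply_right] at h1; exact h1.symm
    · rw [swap_apply_of_ne_of_ne hax hay] at h1
      exact absurd h1 hab

variable {α : Type*} [Fintype α] [DecidableEq α]

open Classical in
lemma sum_offDiag_swap (F : Perm α → ℝ) :
    ∑ p ∈ (univ : Finset α).offDiag, F (swap p.1 p.2) =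
      2 * ∑ τ ∈ univ.filter (fun σ : Perm α => σ.IsSwap), F τ := by
  rw [← Finset.sum_fiberwise_of_maps_to (t := univ.filter (fun σ : Perm α => σ.IsSwap))
    (g := fun p : α × α => swap p.1 p.2), Finset.mul_sum]
  · refine Finset.sum_congr rfl fun τ hτ => ?_
    obtain ⟨x, y, hxy, rfl⟩ := (Finset.mem_filter.1 hτ).2
    have : (univ : Finset α).offDiag.filter (fun p => swap p.1 p.2 = swap x y) = {(x, y), (y, x)} := by
      ext ⟨a, b⟩
      simp only [mem_filter, mem_offDiag, mem_univ, true_and, mem_insert, mem_singleton,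
        Prod.mk.injEq]
      constructor
      · rintro ⟨h1, h2⟩
        exact swap_eq_iff h1 h2
      · rintro (⟨rfl, rfl⟩ | ⟨rfl, rfl⟩)
        · exact ⟨hxy, rfl⟩
        · exact ⟨hxy.symm, swap_comm _ _⟩
    rw [this, Finset.sum_pair]
    · simp only; rw [swap_comm y x]; ring
    · intro h
      rw [Prod.mk.injEq] at h
      exact hxy h.1
  · intro p hp
    simp only [mem_filter, mem_univ, true_and, mem_offDiag] at hp ⊢
    exact ⟨p.1, p.2, hp, rfl⟩

def fixset (σ : Perm α) : Finset α := univ.filter fun x => σ x = x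

lemma subset_fixset {A : Finset α} {σ : Perm α} : A ⊆ fixset σ ↔ ∀ x ∈ A, σ x = x := by
  simp [fixset, Finset.subset_iff]

lemma chain_ineq (σ : Perm α) (Y : Finset α → Perm α → ℝ)
    (hY : ∀ A ρ, (∀ x ∈ A, ρ x = x) → 0 ≤ Y A ρ) :
    ∑ A ∈ (fixset σ).powerset, (∑ p ∈ Aᶜ.offDiag, Y A (σ * swap p.1 p.2) +
      2 * ∑ x ∈ Aᶜ.filter (fun x => σ x ≠ x), Y (insert x A) (σ * swap x (σ⁻¹ x))) ≤
    ∑ p ∈ (univ : Finset α).offDiag, ∑ A ∈ (fixset (σ * swap p.1 p.2)).powerset,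
      Y A (σ * swap p.1 p.2) := by
  set S : Finset ((_ : α × α) × Finset α) := (univ : Finset α).offDiag.sigma
    (fun p => (fixset (σ * swap p.1 p.2)).powerset) with hS
  have hR : ∑ p ∈ (univ : Finset α).offDiag, ∑ A ∈ (fixset (σ * swap p.1 p.2)).powerset,
      Y A (σ * swap p.1 p.2) = ∑ z ∈ S, Y z.2 (σ * swap z.1.1 z.1.2) := by
    rw [hS, Finset.sum_sigma]
  have memS : ∀ z : (_ : α × α) × Finset α, z ∈ S ↔ z.1.1 ≠ z.1.2 ∧
      ∀ x ∈ z.2, σ (swap z.1.1 z.1.2 x) = x := by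
    intro z
    rw [hS, Finset.mem_sigma, Finset.mem_powerset, subset_fixset, mem_offDiag]
    simp
  have e1 : ∑ A ∈ (fixset σ).powerset, ∑ p ∈ Aᶜ.offDiag, Y A (σ * swap p.1 p.2) =
      ∑ z ∈ S.filter (fun z => z.1.1 ∉ z.2 ∧ z.1.2 ∉ z.2), Y z.2 (σ * swap z.1.1 z.1.2) := by
    rw [Finset.sum_sigma']
    refine Finset.sum_bij' (fun z _ => ⟨z.2, z.1⟩) (fun z _ => ⟨z.2, z.1⟩) ?_ ?_ ?_ ?_ ?_
    · rintro ⟨A, p⟩ h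
      simp only [mem_sigma, mem_powerset, subset_fixset, mem_offDiag, mem_compl] at h
      simp only [mem_filter, memS]
      refine ⟨⟨h.2.2.2, ?_⟩, h.2.1, h.2.2.1⟩
      intro x hx
      rw [swap_apply_of_ne_of_ne, h.1 x hx]
      · rintro rfl; exact h.2.1 hx
      · rintro rfl; exact h.2.2.1 hx
    · rintro ⟨p, A⟩ h
      simp only [mem_filter, memS] at h
      simp only [mem_sigma, mem_powerset, subset_fixset, mem_offDiag, mem_compl]
      refine ⟨?_, h.2.1, h.2.2, h.1.1⟩
      intro x hx
      have h1 := h.1.2 x hx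
      rwa [swap_apply_of_ne_of_ne] at h1
      · rintro rfl; exact h.2.1 hx
      · rintro rfl; exact h.2.2 hx
    · intros; rfl
    · intros; rfl
    · intros; rfl
  have e2 : ∑ A ∈ (fixset σ).powerset, ∑ x ∈ Aᶜ.filter (fun x => σ x ≠ x),
        Y (insert x A) (σ * swap x (σ⁻¹ x)) =
      ∑ z ∈ S.filter (fun z => z.1.1 ∈ z.2 ∧ z.1.2 ∉ z.2), Y z.2 (σ * swap z.1.1 z.1.2) := by
    rw [Finset.sum_sigma']
    refine Finset.sum_bij' (fun z _ => ⟨(z.2, σ⁻¹ z.2), insert z.2 z.1⟩)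
      (fun z _ => ⟨z.2.erase z.1.1, z.1.1⟩) ?_ ?_ ?_ ?_ ?_
    · rintro ⟨A, x⟩ h
      simp only [mem_sigma, mem_powerset, subset_fixset, mem_filter, mem_compl] at h
      obtain ⟨hA, hxA, hx⟩ := h
      have hxx : σ (σ⁻¹ x) = x := by simp
      have hx' : σ⁻¹ x ≠ x := by
        intro h; apply hx; rw [Perm.inv_eq_iff_eq] at h; exact h.symm
      have hiA : σ⁻¹ x ∉ A := by
        intro h; have h2 := hA _ h; rw [hxx] at h2; exact hx' h2.symm
      simp only [mem_filter, memS, mem_insert, not_or]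
      refine ⟨⟨hx'.symm, ?_⟩, Or.inl trivial, hx', hiA⟩
      rintro y (rfl | hy)
      · rw [swap_apply_left, hxx]
      · rw [swap_apply_of_ne_of_ne, hA y hy]
        · rintro rfl; exact hxA hy
        · rintro rfl; exact hiA hy
    · rintro ⟨⟨x, y⟩, A⟩ h
      simp only [mem_filter, memS] at h
      obtain ⟨⟨hxy, hA⟩, hx, hy⟩ := h
      have h1 := hA x hx
      rw [swap_apply_left] at h1
      simp only [mem_sigma, mem_powerset, subset_fixset, mem_filter, mem_compl, mem_erase]
      refine ⟨?_, by simp, ?_⟩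
      · rintro w ⟨hw, hwA⟩
        have h2 := hA w hwA
        rwa [swap_apply_of_ne_of_ne hw] at h2
        rintro rfl; exact hy hwA
      · intro h
        apply hxy
        apply σ.injective
        rw [h1, h]
    · rintro ⟨A, x⟩ h
      simp only [mem_sigma, mem_powerset, subset_fixset, mem_filter, mem_compl] at h
      simp [Finset.erase_insert h.2.1]
    · rintro ⟨⟨x, y⟩, A⟩ h
      simp only [mem_filter, memS] at h
      obtain ⟨⟨hxy, hA⟩, hx, hy⟩ := h
      have h1 := hA x hx
      rw [swap_apply_left] at h1
      have : σ⁻¹ x = y := by rw [Perm.inv_eq_iff_eq]; exact h1.symm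
      simp only [this, Finset.insert_erase hx]
    · rintro ⟨A, x⟩ h; rfl
  have e3 : ∑ z ∈ S.filter (fun z => z.1.1 ∈ z.2 ∧ z.1.2 ∉ z.2), Y z.2 (σ * swap z.1.1 z.1.2) =
      ∑ z ∈ S.filter (fun z => z.1.1 ∉ z.2 ∧ z.1.2 ∈ z.2), Y z.2 (σ * swap z.1.1 z.1.2) := by
    refine Finset.sum_bij' (fun z _ => ⟨(z.1.2, z.1.1), z.2⟩) (fun z _ => ⟨(z.1.2, z.1.1), z.2⟩)
      ?_ ?_ ?_ ?_ ?_
    · rintro ⟨⟨x, y⟩, A⟩ h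
      simp only [mem_filter, memS] at h ⊢
      rw [swap_comm y x]
      exact ⟨⟨h.1.1.symm, h.1.2⟩, h.2.2, h.2.1⟩
    · rintro ⟨⟨x, y⟩, A⟩ h
      simp only [mem_filter, memS] at h ⊢
      rw [swap_comm y x]
      exact ⟨⟨h.1.1.symm, h.1.2⟩, h.2.2, h.2.1⟩
    · intros; rfl
    · intros; rfl
    · rintro ⟨⟨x, y⟩, A⟩ h
      simp only; rw [swap_comm y x]
  rw [Finset.sum_add_distrib, ← Finset.mul_sum, e1, e2, two_mul]
  nth_rw 2 [e3]
  rw [hR, ← add_assoc, ← Finset.sum_union, ← Finset.sum_union]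
  · apply Finset.sum_le_sum_of_subset_of_nonneg
    · intro z hz
      simp only [mem_union, mem_filter] at hz
      tauto
    · intro z hz _
      apply hY
      intro x hx
      exact ((memS z).1 hz).2 x hx
  · rw [Finset.disjoint_left]
    intro z hz hz2
    simp only [mem_union, mem_filter] at hz hz2
    tauto
  · rw [Finset.disjoint_left]
    intro z hz hz2
    simp only [mem_filter] at hz hz2
    tauto

end chain
end HookWalk

open Finset Filter Real

namespace HookWalk
open scoped PowerSeries
open Equiv

section walkrec

lemma conv_assoc' {n : ℕ} (a b c : Perm (Fin n) → ℝ) :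
    conv a (conv b c) = conv (conv a b) c := by
  funext g
  simp only [conv, Finset.mul_sum, Finset.sum_mul]
  rw [Finset.sum_comm]
  refine Finset.sum_congr rfl fun l _ => ?_
  rw [← Equiv.sum_comp (Equiv.mulRight l)]
  refine Finset.sum_congr rfl fun h _ => ?_
  simp only [Equiv.coe_mulRight, mul_inv_rev, mul_assoc, mul_inv_cancel, mul_one]

lemma conv_delta {n : ℕ} (a : Perm (Fin n) → ℝ) :
    conv a (fun g => if g = 1 then 1 else 0) = a := by
  funext g
  simp [conv]

lemma walk_zero (n k : ℕ) : walk n k 0 = unifOn (cycles n k) := by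
  rw [walk, convPow, conv_delta]

lemma walk_succ_conv (n k t : ℕ) :
    walk n k (t + 1) = conv (walk n k t) (unifOn (transpositions n)) := by
  rw [walk, convPow, conv_assoc', walk]

lemma transpositions_card (n : ℕ) :
    2 * ((transpositions n).card : ℝ) = (n : ℝ) * (n - 1) := by
  have h := sum_offDiag_swap (α := Fin n) (fun _ => (1 : ℝ))
  simp only [Finset.sum_const, nsmul_eq_mul, mul_one, Finset.offDiag_card, Finset.card_univ,
    Fintype.card_fin] at h
  rw [Nat.cast_sub (Nat.le_mul_self n)] at h
  push_cast at h
  have e : (transpositions n) =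
      @Finset.filter _ (fun σ : Perm (Fin n) => σ.IsSwap) (fun _ => Classical.propDecidable _) univ := by
    ext σ; simp [transpositions]
  rw [e]
  rw [← h]; ring

lemma walk_succ {n : ℕ} (k t : ℕ) (g : Perm (Fin n)) :
    (n : ℝ) * (n - 1) * walk n k (t + 1) g =
      if 2 ≤ n then ∑ p ∈ (univ : Finset (Fin n)).offDiag, walk n k t (g * swap p.1 p.2) else 0 := by
  split_ifs with hn
  · have hc := transpositions_card n
    have h0 : (0 : ℝ) < (n : ℝ) * (n - 1) := by
      have : (2 : ℝ) ≤ n := by exact_mod_cast hn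
      nlinarith
    have hc0 : ((transpositions n).card : ℝ) ≠ 0 := by
      intro h; rw [h] at hc; linarith
    rw [walk_succ_conv, sum_offDiag_swap (fun τ => walk n k t (g * τ)), ← hc, conv]
    have e : (transpositions n) =
        @Finset.filter _ (fun σ : Perm (Fin n) => σ.IsSwap)
          (fun _ => Classical.propDecidable _) univ := by
      ext σ; simp [transpositions]
    rw [← e]
    have : ∀ h : Perm (Fin n), walk n k t (g * h⁻¹) * unifOn (transpositions n) h =
        if h ∈ transpositions n then walk n k t (g * h) / (transpositions n).card else 0 := by
      intro h
      rw [unifOn]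
      split_ifs with hh
      · have : h⁻¹ = h := by
          have h2 : h.IsSwap := by simpa [transpositions] using hh
          obtain ⟨x, y, _, rfl⟩ := h2
          exact swap_inv x y
        rw [this]; ring
      · simp
    rw [Finset.sum_congr rfl fun h _ => this h, Finset.sum_ite_mem, Finset.univ_inter,
      ← Finset.sum_div]
    field_simp
  · have : n = 0 ∨ n = 1 := by omega
    rcases this with rfl | rfl <;> simp

end walkrec

section coeffs

/-- coefficients of the killed chain -/
noncomputable def cc (n k : ℕ) : ℕ → ℕ → ℕ → ℝ
  | 0, a, _ => if a = k then 1 else 0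
  | t + 1, a, j => ((n : ℝ) * (n - 1))⁻¹ *
      ((((n : ℝ) - a) * (n - a - 1) - 2 * (n - a) * j) * cc n k t a j +
        2 * (a + 1) * ((n - a - 1 - j) * cc n k t (a + 1) j + j * cc n k t (a + 1) (j - 1)))

variable {n : ℕ}

noncomputable def yy (n k t : ℕ) (A : Finset (Fin n)) (σ : Perm (Fin n)) : ℝ :=
  ∑ j ∈ range (n - A.card), cc n k t A.card j * uu A.card j σ

noncomputable def YY (n k t : ℕ) (A : Finset (Fin n)) (σ : Perm (Fin n)) : ℝ :=
  (A.card.factorial : ℝ) / n.factorial * yy n k t A σ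

lemma compl_card_real (A : Finset (Fin n)) : ((Aᶜ.card : ℕ) : ℝ) = n - A.card := by
  rw [Finset.card_compl, Fintype.card_fin, Nat.cast_sub]
  simpa using Finset.card_le_univ A

lemma yy_succ (k t : ℕ) (hn : 2 ≤ n) (A : Finset (Fin n)) (σ : Perm (Fin n))
    (hA : ∀ x ∈ A, σ x = x) :
    (n : ℝ) * (n - 1) * yy n k (t + 1) A σ =
      ∑ p ∈ Aᶜ.offDiag, yy n k t A (σ * swap p.1 p.2) +
      2 * (A.card + 1) * ∑ x ∈ Aᶜ.filter (fun x => σ x ≠ x),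
        yy n k t (insert x A) (σ * swap x (σ⁻¹ x)) := by
  have h0 : (n : ℝ) * (n - 1) ≠ 0 := by
    have : (2 : ℝ) ≤ n := by exact_mod_cast hn
    nlinarith
  have e1 : ∑ p ∈ Aᶜ.offDiag, yy n k t A (σ * swap p.1 p.2) =
      ∑ j ∈ range (n - A.card), (((n : ℝ) - A.card) * (n - A.card - 1) - 2 * (n - A.card) * j) *
        cc n k t A.card j * uu A.card j σ := by
    simp only [yy]
    rw [Finset.sum_comm]
    refine Finset.sum_congr rfl fun j _ => ?_
    rw [← Finset.mul_sum, uu_inside σ A hA j, compl_card_real]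
    ring
  have e2 : ∑ x ∈ Aᶜ.filter (fun x => σ x ≠ x), yy n k t (insert x A) (σ * swap x (σ⁻¹ x)) =
      ∑ j ∈ range (n - (A.card + 1)), cc n k t (A.card + 1) j *
        (((n : ℝ) - A.card - 1 - j) * uu A.card j σ + (j + 1) * uu A.card (j + 1) σ) := by
    rw [Finset.sum_congr rfl (g := fun x => ∑ j ∈ range (n - (A.card + 1)),
      cc n k t (A.card + 1) j * uu (A.card + 1) j (σ * swap x (σ⁻¹ x)))]
    · rw [Finset.sum_comm]
      refine Finset.sum_congr rfl fun j _ => ?_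
      rw [← Finset.mul_sum, uu_removal σ A hA j, compl_card_real]
    · intro x hx
      simp only [mem_filter, mem_compl] at hx
      rw [yy, Finset.card_insert_of_notMem hx.1]
  have e3 : ∑ j ∈ range (n - (A.card + 1)), cc n k t (A.card + 1) j *
        (((n : ℝ) - A.card - 1 - j) * uu A.card j σ + (j + 1) * uu A.card (j + 1) σ) =
      ∑ j ∈ range (n - A.card), ((n - A.card - 1 - j) * cc n k t (A.card + 1) j +
        j * cc n k t (A.card + 1) (j - 1)) * uu A.card j σ := by
    rcases Nat.lt_or_ge A.card n with hlt | hge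
    · obtain ⟨m, hm⟩ : ∃ m, n - A.card = m + 1 := ⟨n - A.card - 1, by omega⟩
      have hm2 : n - (A.card + 1) = m := by omega
      have hmr : (n : ℝ) - A.card - 1 = m := by
        have : n = A.card + (m + 1) := by omega
        have h : (n : ℝ) = A.card + (m + 1) := by exact_mod_cast this
        rw [h]; ring
      rw [hm, hm2]
      simp only [hmr, add_mul, mul_add, Finset.sum_add_distrib]
      rw [Finset.sum_range_succ (n := m), Finset.sum_range_succ' (n := m)]
      simp only [sub_self, zero_mul, add_zero, Nat.cast_zero, Nat.add_sub_cancel]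
      congr 1
      · refine Finset.sum_congr rfl fun j _ => by ring
      · rw [← Finset.sum_add_distrib]
        refine Finset.sum_congr rfl fun j _ => ?_
        push_cast; ring
    · have h1 : n - A.card = 0 := by omega
      have h2 : n - (A.card + 1) = 0 := by omega
      rw [h1, h2]; simp
  rw [e1, e2, e3, yy, Finset.mul_sum, Finset.mul_sum, ← Finset.sum_add_distrib]
  refine Finset.sum_congr rfl fun j _ => ?_
  rw [cc, ← mul_assoc, ← mul_assoc, mul_inv_cancel₀ h0]
  ring

lemma YY_succ (k t : ℕ) (hn : 2 ≤ n) (A : Finset (Fin n)) (σ : Perm (Fin n))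
    (hA : ∀ x ∈ A, σ x = x) :
    (n : ℝ) * (n - 1) * YY n k (t + 1) A σ =
      ∑ p ∈ Aᶜ.offDiag, YY n k t A (σ * swap p.1 p.2) +
      2 * ∑ x ∈ Aᶜ.filter (fun x => σ x ≠ x),
        YY n k t (insert x A) (σ * swap x (σ⁻¹ x)) := by
  have h := yy_succ k t hn A σ hA
  have e : ∑ x ∈ Aᶜ.filter (fun x => σ x ≠ x), YY n k t (insert x A) (σ * swap x (σ⁻¹ x)) =
     (A.card.factorial : ℝ) / n.factorial * (A.card + 1) * ∑ x ∈ Aᶜ.filter (fun x => σ x ≠ x),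
        yy n k t (insert x A) (σ * swap x (σ⁻¹ x)) := by
    rw [Finset.mul_sum]
    refine Finset.sum_congr rfl fun x hx => ?_
    simp only [mem_filter, mem_compl] at hx
    rw [YY, Finset.card_insert_of_notMem hx.1, Nat.factorial_succ]
    push_cast; ring
  rw [e]
  simp only [YY]
  rw [← Finset.mul_sum]
  linear_combination ((A.card.factorial : ℝ) / n.factorial) * h

open Classical in
lemma yy_zero (k : ℕ) (hkn : k + 2 ≤ n) (A : Finset (Fin n)) (σ : Perm (Fin n))
    (hA : ∀ x ∈ A, σ x = x) :
    yy n k 0 A σ = if A.card = k ∧ σ.IsCycle ∧ σ.support = Aᶜ then (n : ℝ) - k else 0 := by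
  rw [yy]
  simp only [cc]
  by_cases h : A.card = k
  · have hcard : Aᶜ.card = n - A.card := by rw [Finset.card_compl, Fintype.card_fin]
    have h2 := uu_sum σ A hA (by omega)
    simp only [h, if_true, one_mul, true_and]
    rw [hcard, h] at h2
    rw [h2, Nat.cast_sub (by omega)]
  · simp [h]

lemma YY_nonneg (k t : ℕ) (hkn : k + 2 ≤ n) : ∀ (A : Finset (Fin n)) (σ : Perm (Fin n)),
    (∀ x ∈ A, σ x = x) → 0 ≤ YY n k t A σ := by
  induction t with
  | zero =>
    intro A σ hA
    rw [YY, yy_zero k hkn A σ hA]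
    have : (0 : ℝ) ≤ n - k := by
      have : (k : ℝ) + 2 ≤ n := by exact_mod_cast hkn
      linarith
    split_ifs
    · positivity
    · simp
  | succ t ih =>
    intro A σ hA
    have h := YY_succ k t (by omega) A σ hA
    have h0 : (0 : ℝ) < (n : ℝ) * (n - 1) := by
      have : (k : ℝ) + 2 ≤ n := by exact_mod_cast hkn
      have hk0 : (0 : ℝ) ≤ k := Nat.cast_nonneg k
      nlinarith
    have h1 : 0 ≤ ∑ p ∈ Aᶜ.offDiag, YY n k t A (σ * swap p.1 p.2) := by
      refine Finset.sum_nonneg fun p hp => ih _ _ ?_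
      exact mem_HH.1 (HH_swap hp (mem_HH.2 hA))
    have h2 : 0 ≤ ∑ x ∈ Aᶜ.filter (fun x => σ x ≠ x),
        YY n k t (insert x A) (σ * swap x (σ⁻¹ x)) := by
      refine Finset.sum_nonneg fun x hx => ih _ _ ?_
      simp only [mem_filter, mem_compl] at hx
      intro y hy
      rw [mem_insert] at hy
      rcases hy with rfl | hy
      · simp
      · rw [Perm.mul_apply, swap_apply_of_ne_of_ne, hA y hy]
        · rintro rfl; exact hx.1 hy
        · intro h
          have h3 := hA y hy
          have h4 : σ (σ⁻¹ x) = x := by simp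
          rw [← h, h3] at h4
          exact hx.1 (h4 ▸ hy)
    by_contra hneg
    push Not at hneg
    have := mul_neg_of_pos_of_neg h0 hneg
    linarith

lemma mem_cycles {k : ℕ} {σ : Perm (Fin n)} :
    σ ∈ cycles n k ↔ σ.IsCycle ∧ σ.support.card = n - k := by
  simp [cycles]

lemma support_compl_fixset (σ : Perm (Fin n)) : σ.support = (fixset σ)ᶜ := by
  ext x; simp [fixset]

lemma cycles_card (k : ℕ) (hkn : k + 2 ≤ n) :
    ((cycles n k).card : ℝ) * (k.factorial * (n - k)) = n.factorial := by
  classical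
  have h1 : ∀ A ∈ (univ : Finset (Fin n)).powersetCard k,
      (((cycles n k).filter fun σ => σ.support = Aᶜ).card : ℝ) * (n - k) = (n - k).factorial := by
    intro A hA
    have hAk : A.card = k := (mem_powersetCard.1 hA).2
    have hcard : Aᶜ.card = n - k := by rw [Finset.card_compl, Fintype.card_fin, hAk]
    have h := count_cycles A (by omega)
    rw [Finset.sum_congr rfl fun σ hσ => uu_sum σ A (mem_HH.1 hσ) (by omega), ← Finset.sum_filter,
      Finset.sum_const, nsmul_eq_mul, hcard, Nat.cast_sub (by omega)] at h
    rw [← h]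
    congr 3
    ext σ
    simp only [mem_filter, mem_cycles, mem_HH]
    constructor
    · rintro ⟨⟨h1, h2⟩, h3⟩
      exact ⟨fix_of_support h3, h1, h3⟩
    · rintro ⟨h1, h2, h3⟩
      exact ⟨⟨h2, by rw [h3, hcard]⟩, h3⟩
  have h2 : (cycles n k).card = ∑ A ∈ (univ : Finset (Fin n)).powersetCard k,
      ((cycles n k).filter fun σ => σ.support = Aᶜ).card := by
    rw [Finset.card_eq_sum_card_fiberwise (f := fun σ => σ.supportᶜ)
      (t := (univ : Finset (Fin n)).powersetCard k)]
    · refine Finset.sum_congr rfl fun A _ => ?_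
      congr 1
      ext σ
      simp only [mem_filter]
      constructor
      · rintro ⟨h, h2⟩; exact ⟨h, by rw [← h2, compl_compl]⟩
      · rintro ⟨h, h2⟩; exact ⟨h, by rw [h2, compl_compl]⟩
    · intro σ hσ
      have := (mem_cycles.1 hσ).2
      simp only [Finset.mem_coe, mem_powersetCard, subset_univ, true_and]
      rw [Finset.card_compl, Fintype.card_fin, this]; omega
  rw [h2]
  push_cast
  rw [Finset.sum_mul, Finset.sum_congr rfl (g := fun _ => (k.factorial : ℝ) * (n - k).factorial)]
  · rw [Finset.sum_const, nsmul_eq_mul, card_powersetCard, Finset.card_univ, Fintype.card_fin]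
    have := Nat.choose_mul_factorial_mul_factorial (show k ≤ n by omega)
    rw [← this]; push_cast; ring
  · intro A hA
    rw [← h1 A hA]; ring

lemma walk_ge (k t : ℕ) (hkn : k + 2 ≤ n) : ∀ σ : Perm (Fin n),
    ∑ A ∈ (fixset σ).powerset, YY n k t A σ ≤ walk n k t σ := by
  classical
  induction t with
  | zero =>
    intro σ
    rw [walk_zero, unifOn]
    have hY : ∀ A ∈ (fixset σ).powerset, YY n k 0 A σ =
        if A = fixset σ then (if σ ∈ cycles n k then (1 : ℝ) / (cycles n k).card else 0) else 0 := by
      intro A hA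
      have hA' := subset_fixset.1 (mem_powerset.1 hA)
      rw [YY, yy_zero k hkn A σ hA']
      by_cases h : A = fixset σ
      · rw [if_pos h]
        have hs := support_compl_fixset σ
        rw [← h] at hs
        have hcA : Aᶜ.card = n - A.card := by rw [Finset.card_compl, Fintype.card_fin]
        have hAn : A.card ≤ n := by simpa using Finset.card_le_univ A
        have hiff : (A.card = k ∧ σ.IsCycle ∧ σ.support = Aᶜ) ↔ σ ∈ cycles n k := by
          rw [mem_cycles, hs, hcA]
          constructor
          · rintro ⟨h1, h2, _⟩; exact ⟨h2, by omega⟩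
          · rintro ⟨h1, h2⟩; exact ⟨by omega, h1, rfl⟩
        by_cases hc : σ ∈ cycles n k
        · rw [if_pos (hiff.2 hc), if_pos hc, (hiff.2 hc).1]
          have hcard := cycles_card k hkn
          have : ((cycles n k).card : ℝ) ≠ 0 := by
            have := Finset.card_pos.2 ⟨σ, hc⟩
            positivity
          have hf : (n.factorial : ℝ) ≠ 0 := by positivity
          rw [div_mul_eq_mul_div, div_eq_div_iff hf this]
          linarith
        · rw [if_neg (fun h => hc (hiff.1 h)), if_neg hc, mul_zero]
      · rw [if_neg h, if_neg, mul_zero]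
        rintro ⟨_, _, h3⟩
        apply h
        rw [support_compl_fixset] at h3
        exact (compl_injective h3).symm
    rw [Finset.sum_congr rfl hY, Finset.sum_ite_eq']
    simp
  | succ t ih =>
    intro σ
    have h0 : (0 : ℝ) < (n : ℝ) * (n - 1) := by
      have : (k : ℝ) + 2 ≤ n := by exact_mod_cast hkn
      have hk0 : (0 : ℝ) ≤ k := Nat.cast_nonneg k
      nlinarith
    refine le_of_mul_le_mul_left ?_ h0
    rw [walk_succ, if_pos (by omega), Finset.mul_sum,
      Finset.sum_congr rfl fun A hA =>
        YY_succ k t (by omega) A σ (subset_fixset.1 (mem_powerset.1 hA))]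
    refine (chain_ineq σ (YY n k t) (YY_nonneg k t hkn)).trans ?_
    exact Finset.sum_le_sum fun p _ => ih _

end coeffs
end HookWalk

open Finset Filter Real

namespace HookWalk
open Equiv

section scalars
variable {n k : ℕ}

lemma cc_gt (t : ℕ) : ∀ a j, k < a → cc n k t a j = 0 := by
  induction t with
  | zero => intro a j h; simp [cc]; omega
  | succ t ih =>
    intro a j h
    rw [cc, ih a j h, ih (a + 1) j (by omega), ih (a + 1) (j - 1) (by omega)]; ring

lemma N_pos (hkn : k + 2 ≤ n) : (0 : ℝ) < (n : ℝ) * (n - 1) := by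
  have : (k : ℝ) + 2 ≤ n := by exact_mod_cast hkn
  have hk0 : (0 : ℝ) ≤ k := Nat.cast_nonneg k
  nlinarith

lemma PP_succ (hkn : k + 2 ≤ n) (t a : ℕ) : (n : ℝ) * (n - 1) * cc n k (t + 1) a 0 =
    ((n : ℝ) - a) * (n - a - 1) * cc n k t a 0 +
      2 * (a + 1) * (n - a - 1) * cc n k t (a + 1) 0 := by
  have h0 := (N_pos hkn).ne'
  rw [cc, ← mul_assoc, mul_inv_cancel₀ h0]
  push_cast; ring

lemma PP_nonneg (hkn : k + 2 ≤ n) (t : ℕ) : ∀ a, 0 ≤ cc n k t a 0 := by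
  induction t with
  | zero => intro a; simp only [cc]; split_ifs <;> norm_num
  | succ t ih =>
    intro a
    rcases Nat.lt_or_ge k a with h | h
    · rw [cc_gt _ _ _ h]
    · have h0 := N_pos hkn
      have hs := PP_succ hkn t a
      have h1 : (0 : ℝ) ≤ n - a - 1 := by
        have : (a : ℝ) + 2 ≤ n := by exact_mod_cast (by omega : a + 2 ≤ n)
        linarith
      have h2 : (0 : ℝ) ≤ ((n : ℝ) - a) * (n - a - 1) * cc n k t a 0 +
          2 * (a + 1) * (n - a - 1) * cc n k t (a + 1) 0 := by
        have i1 := ih a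
        have i2 := ih (a + 1)
        have h3 : (0 : ℝ) ≤ n - a := by linarith
        positivity
      by_contra hneg
      push Not at hneg
      have := mul_neg_of_pos_of_neg h0 hneg
      linarith

lemma shift_sum (F : ℕ → ℝ) (g : ℕ → ℝ) (hF : F (k + 1) = 0) (hg : g 0 = 0) :
    ∑ a ∈ range (k + 1), g (a + 1) * F (a + 1) = ∑ a ∈ range (k + 1), g a * F a := by
  rw [Finset.sum_range_succ, Finset.sum_range_succ', hF, hg]; simp

lemma PP_sum_succ (hkn : k + 2 ≤ n) (t : ℕ) :
    (n : ℝ) * (n - 1) * ∑ a ∈ range (k + 1), cc n k (t + 1) a 0 =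
      ∑ a ∈ range (k + 1), ((n : ℝ) * (n - 1) - a * (a - 1)) * cc n k t a 0 := by
  rw [Finset.mul_sum, Finset.sum_congr rfl fun a _ => PP_succ hkn t a, Finset.sum_add_distrib]
  have h := shift_sum (k := k) (fun a => cc n k t a 0) (fun a => 2 * (a : ℝ) * (n - a))
    (cc_gt _ _ _ (by omega)) (by simp)
  push_cast at h
  have h2 : ∑ x ∈ range (k + 1), 2 * ((x : ℝ) + 1) * (n - x - 1) * cc n k t (x + 1) 0 =
      ∑ x ∈ range (k + 1), 2 * (x : ℝ) * (n - x) * cc n k t x 0 := by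
    rw [← h]
    refine Finset.sum_congr rfl fun x _ => by ring
  rw [h2, ← Finset.sum_add_distrib]
  refine Finset.sum_congr rfl fun x _ => by ring

lemma PP_sum_zero : ∑ a ∈ range (k + 1), cc n k 0 a 0 = 1 := by
  simp [cc]

lemma PP_sum_le (hkn : k + 2 ≤ n) (t : ℕ) : ∑ a ∈ range (k + 1), cc n k t a 0 ≤ 1 := by
  induction t with
  | zero => rw [PP_sum_zero]
  | succ t ih =>
    have h := PP_sum_succ hkn t
    have h0 := N_pos hkn
    have h1 : ∑ a ∈ range (k + 1), ((n : ℝ) * (n - 1) - a * (a - 1)) * cc n k t a 0 ≤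
        ∑ a ∈ range (k + 1), ((n : ℝ) * (n - 1)) * cc n k t a 0 := by
      refine Finset.sum_le_sum fun a _ => ?_
      apply mul_le_mul_of_nonneg_right _ (PP_nonneg hkn t a)
      have : (0 : ℝ) ≤ a * (a - 1) := by
        rcases Nat.eq_zero_or_pos a with h | h
        · simp [h]
        · have : (1 : ℝ) ≤ a := by exact_mod_cast h
          nlinarith
      linarith
    rw [← Finset.mul_sum, ← h] at h1
    exact (le_of_mul_le_mul_left h1 h0).trans ih

lemma PP_sum_ge (hkn : k + 2 ≤ n) (t : ℕ) :
    1 - t * (k : ℝ) ^ 2 / (n * (n - 1)) ≤ ∑ a ∈ range (k + 1), cc n k t a 0 := by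
  induction t with
  | zero => rw [PP_sum_zero]; simp
  | succ t ih =>
    have h := PP_sum_succ hkn t
    have h0 := N_pos hkn
    have h1 : ∑ a ∈ range (k + 1), ((n : ℝ) * (n - 1) - (k : ℝ) ^ 2) * cc n k t a 0 ≤
        ∑ a ∈ range (k + 1), ((n : ℝ) * (n - 1) - a * (a - 1)) * cc n k t a 0 := by
      refine Finset.sum_le_sum fun a ha => ?_
      apply mul_le_mul_of_nonneg_right _ (PP_nonneg hkn t a)
      have h1 : (a : ℝ) ≤ k := by
        have := Finset.mem_range.1 ha
        exact_mod_cast (by omega : a ≤ k)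
      have h2 : (0 : ℝ) ≤ a := Nat.cast_nonneg a
      nlinarith
    rw [← Finset.mul_sum, ← h] at h1
    have h2 := PP_sum_le hkn t
    have h3 : ∑ a ∈ range (k + 1), cc n k t a 0 - (k : ℝ) ^ 2 / (n * (n - 1)) ≤
        ∑ a ∈ range (k + 1), cc n k (t + 1) a 0 := by
      refine le_of_mul_le_mul_left ?_ h0
      refine le_trans ?_ h1
      rw [mul_sub, mul_div_cancel₀ _ h0.ne', sub_mul]
      have := mul_le_mul_of_nonneg_left h2 (sq_nonneg (k : ℝ))
      linarith
    push_cast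
    have e : ((t : ℝ) + 1) * (k : ℝ) ^ 2 / (n * (n - 1)) =
      t * (k : ℝ) ^ 2 / (n * (n - 1)) + (k : ℝ) ^ 2 / (n * (n - 1)) := by ring
    linarith

lemma PM_le (hkn : k + 2 ≤ n) (t : ℕ) :
    ∑ a ∈ range (k + 1), (a : ℝ) * cc n k t a 0 ≤ k * (1 - 2 / (n : ℝ)) ^ t := by
  have h0 := N_pos hkn
  have hn2 : (k : ℝ) + 2 ≤ n := by exact_mod_cast hkn
  have hk0 : (0 : ℝ) ≤ k := Nat.cast_nonneg k
  induction t with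
  | zero =>
    simp [cc]
  | succ t ih =>
    have h : (n : ℝ) * (n - 1) * ∑ a ∈ range (k + 1), (a : ℝ) * cc n k (t + 1) a 0 =
        ∑ a ∈ range (k + 1), (a : ℝ) * ((n - a) * (n + a - 3)) * cc n k t a 0 := by
      have e0 : ∀ a ∈ range (k + 1), (n : ℝ) * (n - 1) * ((a : ℝ) * cc n k (t + 1) a 0) =
          (a : ℝ) * (((n : ℝ) - a) * (n - a - 1) * cc n k t a 0) +
          a * (2 * (a + 1) * (n - a - 1) * cc n k t (a + 1) 0) := by
        intro a _
        have := PP_succ hkn t a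
        linear_combination (a : ℝ) * this
      rw [Finset.mul_sum, Finset.sum_congr rfl e0, Finset.sum_add_distrib]
      have h := shift_sum (k := k) (fun a => cc n k t a 0) (fun a => 2 * (a : ℝ) * (a - 1) * (n - a))
        (cc_gt _ _ _ (by omega)) (by simp)
      push_cast at h
      have h2 : ∑ x ∈ range (k + 1), (x : ℝ) * (2 * ((x : ℝ) + 1) * (n - x - 1) * cc n k t (x + 1) 0) =
          ∑ x ∈ range (k + 1), 2 * (x : ℝ) * (x - 1) * (n - x) * cc n k t x 0 := by
        rw [← h]
        refine Finset.sum_congr rfl fun x _ => by ring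
      rw [h2, ← Finset.sum_add_distrib]
      refine Finset.sum_congr rfl fun x _ => by ring
    have h1 : ∑ a ∈ range (k + 1), (a : ℝ) * ((n - a) * (n + a - 3)) * cc n k t a 0 ≤
        ∑ a ∈ range (k + 1), ((n : ℝ) * (n - 1) * (1 - 2 / n)) * (a * cc n k t a 0) := by
      refine Finset.sum_le_sum fun a _ => ?_
      rw [mul_comm (a : ℝ), mul_assoc]
      have hp : 0 ≤ (a : ℝ) * cc n k t a 0 := mul_nonneg (Nat.cast_nonneg a) (PP_nonneg hkn t a)
      rcases Nat.eq_zero_or_pos a with h | h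
      · simp [h]
      · apply mul_le_mul_of_nonneg_right _ hp
        have e : (n : ℝ) * (n - 1) * (1 - 2 / n) = n ^ 2 - 3 * n + 2 := by
          have : (n : ℝ) ≠ 0 := by linarith
          field_simp; ring
        rw [e]
        have h12 : (0 : ℝ) ≤ (a - 1) * (a - 2) := by
          rcases Nat.lt_or_ge a 2 with h' | h'
          · have : a = 1 := by omega
            simp [this]
          · have : (2 : ℝ) ≤ a := by exact_mod_cast h'
            nlinarith
        nlinarith
    rw [← Finset.mul_sum, ← h, mul_assoc ((n : ℝ) * (n - 1)) (1 - 2 / (n : ℝ))] at h1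
    have h2 := le_of_mul_le_mul_left h1 h0
    refine h2.trans ?_
    rw [pow_succ, mul_comm (_ ^ t), ← mul_assoc, mul_comm (k : ℝ), mul_assoc]
    apply mul_le_mul_of_nonneg_left ih
    rw [sub_nonneg, div_le_one (by linarith)]
    linarith

lemma cc_top (hkn : k + 2 ≤ n) (t : ℕ) : ∀ a, a ≤ k →
    cc n k t a (n - a - 1) = (-1) ^ (t + k - a) * cc n k t a 0 := by
  induction t with
  | zero =>
    intro a ha
    simp only [cc]
    split_ifs with h
    · simp [h]
    · simp
  | succ t ih =>
    intro a ha
    have hj : ((n - a - 1 : ℕ) : ℝ) = n - a - 1 := by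
      rw [Nat.cast_sub (by omega), Nat.cast_sub (by omega)]; simp
    have h0 := (N_pos hkn).ne'
    have h1 := PP_succ hkn t a
    apply mul_left_cancel₀ h0
    rw [mul_left_comm, h1]
    rw [cc, ← mul_assoc, mul_inv_cancel₀ h0, ih a ha, hj]
    have e1 : t + 1 + k - a = (t + k - a) + 1 := by omega
    rw [e1, pow_succ]
    rcases Nat.lt_or_ge a k with h | h
    · have i2 := ih (a + 1) (by omega)
      have e2 : n - (a + 1) - 1 = n - a - 1 - 1 := by omega
      have e3 : t + k - a = (t + k - (a + 1)) + 1 := by omega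
      rw [e2] at i2
      rw [i2, e3, pow_succ]
      ring
    · rw [cc_gt t (a + 1) _ (by omega), cc_gt t (a + 1) _ (by omega), cc_gt t (a + 1) _ (by omega)]
      ring

end scalars
end HookWalk

open Finset Filter Real

namespace HookWalk
open Equiv

section bounds

lemma pow_bern (x y : ℝ) (hx : 0 ≤ x) (hy : 0 ≤ y) (e : ℕ) :
    x ^ e + e * x ^ (e - 1) * y ≤ (x + y) ^ e := by
  induction e with
  | zero => simp
  | succ e ih =>
    rw [pow_succ (x + y)]
    have h1 := mul_le_mul_of_nonneg_right ih (add_nonneg hx hy)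
    refine le_trans ?_ h1
    rcases Nat.eq_zero_or_pos e with h | h
    · subst h; simp
    · obtain ⟨d, rfl⟩ : ∃ d, e = d + 1 := ⟨e - 1, by omega⟩
      simp only [Nat.add_sub_cancel]
      have : 0 ≤ ((d : ℝ) + 1) * x ^ d * y * y := by positivity
      push_cast
      have e1 : (x ^ (d + 1) + ((d : ℝ) + 1) * x ^ d * y) * (x + y) =
        x ^ (d + 1 + 1) + ((d : ℝ) + 1 + 1) * x ^ (d + 1) * y + ((d : ℝ) + 1) * x ^ d * y * y := by
        ring
      rw [e1]; linarith

lemma ins_bound (M j : ℕ) (c : ℕ → ℝ) (P ψ : ℝ) (hP : 0 ≤ P) (hψ : 0 ≤ ψ) (hM : 1 ≤ M)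
    (hj : j ≤ M) (hc : ∀ i, i ≤ M - 1 → |c i| ≤ P * ψ ^ min i (M - 1 - i)) :
    |((M : ℝ) - j) * c j + j * c (j - 1)| ≤ M * (P * (ψ + 2 / M) ^ min j (M - j)) := by
  have hM0 : (0 : ℝ) < M := by exact_mod_cast hM
  have hjr : (j : ℝ) ≤ M := by exact_mod_cast hj
  have hj0 : (0 : ℝ) ≤ j := Nat.cast_nonneg j
  have hb := pow_bern ψ (2 / M) hψ (by positivity) (min j (M - j))
  set e := min j (M - j) with he
  have hb2 : P * (M * ψ ^ e + 2 * e * ψ ^ (e - 1)) ≤ M * (P * (ψ + 2 / M) ^ e) := by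
    rw [mul_left_comm]
    apply mul_le_mul_of_nonneg_left _ hP
    have := mul_le_mul_of_nonneg_left hb hM0.le
    refine le_trans (le_of_eq ?_) this
    field_simp
  refine le_trans ?_ hb2
  have hA : |((M : ℝ) - j) * c j| ≤ ((M : ℝ) - j) * (P * ψ ^ min j (M - 1 - j)) := by
    rw [abs_mul, abs_of_nonneg (sub_nonneg.2 hjr)]
    rcases Nat.lt_or_ge j M with h | h
    · exact mul_le_mul_of_nonneg_left (hc j (by omega)) (sub_nonneg.2 hjr)
    · have : j = M := by omega
      subst this; simp
  have hB : |(j : ℝ) * c (j - 1)| ≤ j * (P * ψ ^ min (j - 1) (M - 1 - (j - 1))) := by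
    rw [abs_mul, abs_of_nonneg hj0]
    exact mul_le_mul_of_nonneg_left (hc (j - 1) (by omega)) hj0
  refine (abs_add_le _ _).trans ((add_le_add hA hB).trans ?_)
  have key : ((M : ℝ) - j) * ψ ^ min j (M - 1 - j) + j * ψ ^ min (j - 1) (M - 1 - (j - 1)) ≤
      M * ψ ^ e + 2 * e * ψ ^ (e - 1) := by
    rcases Nat.eq_zero_or_pos j with h0 | h0
    · subst h0; simp [he]
    rcases Nat.lt_trichotomy (2 * j) M with h | h | h
    · have a1 : min j (M - 1 - j) = j := by omega
      have a2 : min (j - 1) (M - 1 - (j - 1)) = j - 1 := by omega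
      have a3 : e = j := by omega
      rw [a1, a2, a3]
      have p1 : 0 ≤ (j : ℝ) * ψ ^ j := by positivity
      have p2 : 0 ≤ (j : ℝ) * ψ ^ (j - 1) := by positivity
      linarith
    · have a1 : min j (M - 1 - j) = j - 1 := by omega
      have a2 : min (j - 1) (M - 1 - (j - 1)) = j - 1 := by omega
      have a3 : e = j := by omega
      rw [a1, a2, a3]
      have hr : (M : ℝ) = 2 * j := by exact_mod_cast h.symm
      have p1 : 0 ≤ (j : ℝ) * ψ ^ j := by positivity
      rw [hr]; linarith
    · rcases Nat.lt_or_ge j M with hlt | hge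
      · have a1 : min j (M - 1 - j) = M - j - 1 := by omega
        have a2 : min (j - 1) (M - 1 - (j - 1)) = M - j := by omega
        have a3 : e = M - j := by omega
        rw [a1, a2, a3, Nat.cast_sub hj]
        have p1 : 0 ≤ ((M : ℝ) - j) * ψ ^ (M - j) :=
          mul_nonneg (sub_nonneg.2 hjr) (by positivity)
        have p2 : 0 ≤ ((M : ℝ) - j) * ψ ^ (M - j - 1) :=
          mul_nonneg (sub_nonneg.2 hjr) (by positivity)
        linarith
      · have : j = M := by omega
        subst this
        have a2 : min (j - 1) (j - 1 - (j - 1)) = 0 := by omega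
        have a3 : e = 0 := by omega
        rw [a2, a3]; simp
  have := mul_le_mul_of_nonneg_left key hP
  linarith

/-- decay factor -/
noncomputable def psi (n k t a : ℕ) : ℝ :=
  (1 - 2 / ((n : ℝ) - 1)) ^ (t + a) / (1 - 2 / ((n : ℝ) - 1)) ^ k + 2 * (k - a) / (n - k)

lemma Prod_nonneg {n k : ℕ} (hn : 4 ≤ n) (hkn : k + 3 ≤ n) (t a : ℕ) (ha : a ≤ k) :
    0 ≤ psi n k t a := by
  have h4 : (4 : ℝ) ≤ n := by exact_mod_cast hn
  have hk3 : (k : ℝ) + 3 ≤ n := by exact_mod_cast hkn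
  have har : (a : ℝ) ≤ k := by exact_mod_cast ha
  have hr : (0 : ℝ) ≤ 1 - 2 / ((n : ℝ) - 1) := by
    rw [sub_nonneg, div_le_one (by linarith)]; linarith
  rw [psi]
  have : (0 : ℝ) ≤ 2 * (k - a) / (n - k) := div_nonneg (by linarith) (by linarith)
  positivity

lemma cc_bound {n k : ℕ} (hn : 4 ≤ n) (hkn : k + 3 ≤ n) (t : ℕ) : ∀ a j, a ≤ k → j ≤ n - a - 1 →
    |cc n k t a j| ≤ cc n k t a 0 * psi n k t a ^ min j (n - a - 1 - j) := by
  have h4 : (4 : ℝ) ≤ n := by exact_mod_cast hn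
  have hk3 : (k : ℝ) + 3 ≤ n := by exact_mod_cast hkn
  have hr : (0 : ℝ) < 1 - 2 / ((n : ℝ) - 1) := by
    rw [sub_pos, div_lt_one (by linarith)]; linarith
  have hr1 : 1 - 2 / ((n : ℝ) - 1) ≤ 1 := by
    have : (0 : ℝ) ≤ 2 / ((n : ℝ) - 1) := div_nonneg (by norm_num) (by linarith)
    linarith
  induction t with
  | zero =>
    intro a j ha hj
    rcases eq_or_ne a k with h | h
    · subst h
      have : psi n a 0 a = 1 := by
        rw [psi]; simp [div_self (pow_pos hr a).ne']
      rw [this]; simp [cc]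
    · simp [cc, h]
  | succ t ih =>
    intro a j ha hj
    have har : (a : ℝ) ≤ k := by exact_mod_cast ha
    have h0 := N_pos (by omega : k + 2 ≤ n)
    have hs := PP_succ (by omega : k + 2 ≤ n) t a
    have hP := PP_nonneg (by omega : k + 2 ≤ n) t a
    have hP1 := PP_nonneg (by omega : k + 2 ≤ n) t (a + 1)
    have hM : ((n - a - 1 : ℕ) : ℝ) = n - a - 1 := by
      rw [Nat.cast_sub (by omega), Nat.cast_sub (by omega)]; simp
    set M := n - a - 1 with hMdef
    have hM2 : 2 ≤ M := by omega
    have hM2r : (2 : ℝ) ≤ M := by exact_mod_cast hM2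
    have hjr : (j : ℝ) ≤ M := by exact_mod_cast hj
    have hψ := Prod_nonneg hn hkn t a ha
    set e := min j (M - j) with he
    -- inner part
    have hin : |((n : ℝ) - a) * (n - a - 1 - 2 * j) * cc n k t a j| ≤
        ((n : ℝ) - a) * (n - a - 1) * cc n k t a 0 * psi n k (t + 1) a ^ e := by
      rw [← hM, abs_mul, abs_mul, abs_of_nonneg (by linarith : (0 : ℝ) ≤ n - a), mul_assoc, mul_assoc,
        mul_assoc]
      apply mul_le_mul_of_nonneg_left _ (by linarith)
      have b1 : |(M : ℝ) - 2 * j| = M - 2 * e := by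
        rcases le_total (2 * j) M with h | h
        · have : e = j := by omega
          rw [this, abs_of_nonneg]
          have : ((2 * j : ℕ) : ℝ) ≤ M := by exact_mod_cast h
          push_cast at this; linarith
        · have : e = M - j := by omega
          have h' : (M : ℝ) ≤ ((2 * j : ℕ) : ℝ) := by exact_mod_cast h
          push_cast at h'
          rw [this, Nat.cast_sub hj, abs_of_nonpos (by linarith)]; ring
      have b2 : (M : ℝ) - 2 * e ≤ M * (1 - 2 / ((n : ℝ) - 1)) ^ e := by
        have hd : (2 : ℝ) / M ≤ 1 := by rw [div_le_one (by linarith)]; exact hM2r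
        have c1 := one_add_mul_le_pow (a := -(2 / (M : ℝ))) (by linarith) e
        have c2 : (1 + -(2 / (M : ℝ))) ^ e ≤ (1 - 2 / ((n : ℝ) - 1)) ^ e := by
          apply pow_le_pow_left₀ (by linarith)
          have : 2 / ((n : ℝ) - 1) ≤ 2 / M := by
            apply div_le_div_of_nonneg_left (by norm_num) (by linarith)
            have := (Nat.cast_nonneg a : (0 : ℝ) ≤ a)
            linarith
          linarith
        have c3 := mul_le_mul_of_nonneg_left (c1.trans c2) (by linarith : (0 : ℝ) ≤ M)
        refine le_trans (le_of_eq ?_) c3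
        have : (M : ℝ) ≠ 0 := by linarith
        field_simp
        ring
      have b3 : (1 - 2 / ((n : ℝ) - 1)) * psi n k t a ≤ psi n k (t + 1) a := by
        rw [psi, psi, mul_add]
        have c1 : (1 - 2 / ((n : ℝ) - 1)) * ((1 - 2 / ((n : ℝ) - 1)) ^ (t + a) /
            (1 - 2 / ((n : ℝ) - 1)) ^ k) = (1 - 2 / ((n : ℝ) - 1)) ^ (t + 1 + a) /
            (1 - 2 / ((n : ℝ) - 1)) ^ k := by
          rw [show t + 1 + a = (t + a) + 1 by ring, pow_succ]; ring
        have c2 : (1 - 2 / ((n : ℝ) - 1)) * (2 * ((k : ℝ) - a) / (n - k)) ≤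
            2 * ((k : ℝ) - a) / (n - k) :=
          mul_le_of_le_one_left (div_nonneg (by linarith) (by linarith)) hr1
        linarith
      calc |(M : ℝ) - 2 * j| * |cc n k t a j|
          ≤ (M * (1 - 2 / ((n : ℝ) - 1)) ^ e) * (cc n k t a 0 * psi n k t a ^ e) := by
            rw [b1]
            apply mul_le_mul b2 (ih a j ha hj) (abs_nonneg _)
            positivity
        _ = (M * cc n k t a 0) * ((1 - 2 / ((n : ℝ) - 1)) * psi n k t a) ^ e := by
            rw [mul_pow]; ring
        _ ≤ (M * cc n k t a 0) * psi n k (t + 1) a ^ e := by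
            apply mul_le_mul_of_nonneg_left _ (by positivity)
            exact pow_le_pow_left₀ (by positivity) b3 _
        _ = _ := by ring
    have hout : |((n : ℝ) - a - 1 - j) * cc n k t (a + 1) j + j * cc n k t (a + 1) (j - 1)| ≤
        (n - a - 1) * (cc n k t (a + 1) 0 * psi n k (t + 1) a ^ e) := by
      rw [← hM]
      rcases Nat.lt_or_ge a k with h | h
      · have hψ1 := Prod_nonneg hn hkn t (a + 1) h
        have i := ins_bound M j (cc n k t (a + 1)) (cc n k t (a + 1) 0) (psi n k t (a + 1))
          hP1 hψ1 (by omega) hj (fun i hi => by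
            have := ih (a + 1) i h (by omega)
            rwa [show n - (a + 1) - 1 - i = M - 1 - i by omega] at this)
        refine i.trans ?_
        apply mul_le_mul_of_nonneg_left _ (by linarith)
        apply mul_le_mul_of_nonneg_left _ hP1
        apply pow_le_pow_left₀ (by positivity)
        rw [psi, psi, show t + (a + 1) = t + 1 + a by ring]
        have : (2 : ℝ) / M ≤ 2 / (n - k) := by
          apply div_le_div_of_nonneg_left (by norm_num) (by linarith)
          rw [hM]
          have : (a : ℝ) + 1 ≤ k := by exact_mod_cast h
          linarith
        have e2 : (2 : ℝ) * (k - a) / (n - k) = 2 * (k - (a + 1 : ℕ)) / (n - k) + 2 / (n - k) := by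
          push_cast; ring
        rw [e2]; linarith
      · rw [cc_gt t (a + 1) _ (by omega), cc_gt t (a + 1) _ (by omega),
          cc_gt t (a + 1) _ (by omega)]
        simp
    refine le_of_mul_le_mul_left ?_ h0
    rw [← abs_of_pos h0, ← abs_mul, abs_of_pos h0, ← mul_assoc, hs]
    have e1 : (n : ℝ) * (n - 1) * cc n k (t + 1) a j =
        ((n : ℝ) - a) * (n - a - 1 - 2 * j) * cc n k t a j +
        2 * (a + 1) * (((n : ℝ) - a - 1 - j) * cc n k t (a + 1) j + j * cc n k t (a + 1) (j - 1)) := by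
      rw [cc, ← mul_assoc, mul_inv_cancel₀ h0.ne']; ring
    rw [e1]
    refine (abs_add_le _ _).trans ?_
    rw [abs_mul (2 * ((a : ℝ) + 1)), abs_of_nonneg (by positivity : (0 : ℝ) ≤ 2 * ((a : ℝ) + 1))]
    have h3 := mul_le_mul_of_nonneg_left hout (by positivity : (0 : ℝ) ≤ 2 * ((a : ℝ) + 1))
    linarith

lemma geo_le (x : ℝ) (h0 : 0 ≤ x) (h1 : x < 1) (M : ℕ) :
    ∑ j ∈ Finset.Ico 1 M, x ^ j ≤ x / (1 - x) := by
  have h : (∑ j ∈ Finset.Ico 1 M, x ^ j) * (1 - x) ≤ x := by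
    induction M with
    | zero => simpa using h0
    | succ M ih =>
      rcases Nat.eq_zero_or_pos M with h | h
      · subst h; simpa using h0
      · rw [geom_sum_Ico_mul_neg x (by omega)]
        have : 0 ≤ x ^ (M + 1) := by positivity
        simp; positivity
  rwa [le_div_iff₀ (by linarith)]

lemma cc_sq_sum {n k : ℕ} (hn : 4 ≤ n) (hkn : k + 3 ≤ n) (t a : ℕ) (ha : a ≤ k) (Ψ : ℝ)
    (hΨ : psi n k t a ≤ Ψ) (hΨ1 : Ψ < 1) :
    ∑ j ∈ Finset.Ico 1 (n - a - 1), cc n k t a j ^ 2 ≤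
      2 * cc n k t a 0 ^ 2 * (Ψ ^ 2 / (1 - Ψ ^ 2)) := by
  have hψ := Prod_nonneg hn hkn t a ha
  have hP := PP_nonneg (by omega : k + 2 ≤ n) t a
  set M := n - a - 1 with hM
  have hΨ0 : 0 ≤ Ψ := hψ.trans hΨ
  have h1 : ∀ j ∈ Finset.Ico 1 M, cc n k t a j ^ 2 ≤
      cc n k t a 0 ^ 2 * ((Ψ ^ 2) ^ j + (Ψ ^ 2) ^ (M - j)) := by
    intro j hj
    rw [Finset.mem_Ico] at hj
    have hb := cc_bound hn hkn t a j ha (by omega)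
    have hb2 : |cc n k t a j| ≤ cc n k t a 0 * Ψ ^ min j (M - j) :=
      hb.trans (mul_le_mul_of_nonneg_left (pow_le_pow_left₀ hψ hΨ _) hP)
    have hb3 := pow_le_pow_left₀ (abs_nonneg _) hb2 2
    rw [sq_abs, mul_pow, ← pow_mul, mul_comm _ 2, pow_mul] at hb3
    refine hb3.trans (mul_le_mul_of_nonneg_left ?_ (sq_nonneg _))
    have p1 : 0 ≤ (Ψ ^ 2) ^ j := by positivity
    have p2 : 0 ≤ (Ψ ^ 2) ^ (M - j) := by positivity
    rcases min_choice j (M - j) with h | h <;> rw [h] <;> linarith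
  refine (Finset.sum_le_sum h1).trans ?_
  rw [← Finset.mul_sum, Finset.sum_add_distrib]
  have h2 : ∑ j ∈ Finset.Ico 1 M, (Ψ ^ 2) ^ (M - j) = ∑ j ∈ Finset.Ico 1 M, (Ψ ^ 2) ^ j := by
    apply Finset.sum_bij' (fun j _ => M - j) (fun j _ => M - j) <;>
      (intro j hj; rw [Finset.mem_Ico] at *; try omega)
  rw [h2]
  have h3 := geo_le (Ψ ^ 2) (sq_nonneg _) (by nlinarith) M
  have h4 := mul_le_mul_of_nonneg_left h3 (sq_nonneg (cc n k t a 0))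
  linarith

end bounds
end HookWalk

open Finset Filter Real

namespace HookWalk
open Equiv

section tv
variable {n : ℕ}

lemma HH_empty : HH (∅ : Finset (Fin n)) = univ := by
  ext σ; simp [mem_HH]

lemma walk_expect (k t : ℕ) (hn : 2 ≤ n) (F : Perm (Fin n) → ℝ) :
    (n : ℝ) * (n - 1) * ∑ σ, walk n k (t + 1) σ * F σ =
      ∑ σ, walk n k t σ * ∑ p ∈ (univ : Finset (Fin n)).offDiag, F (σ * swap p.1 p.2) := by
  have h := selfadj (∅ : Finset (Fin n)) (walk n k t) F
  rw [HH_empty, Finset.compl_empty] at h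
  rw [← h, Finset.mul_sum]
  refine Finset.sum_congr rfl fun σ _ => ?_
  rw [← mul_assoc, walk_succ, if_pos hn]

lemma offDiag_card_real : (((univ : Finset (Fin n)).offDiag).card : ℝ) = n * (n - 1) := by
  rw [Finset.offDiag_card, Finset.card_univ, Fintype.card_fin, Nat.cast_sub (Nat.le_mul_self n)]
  push_cast; ring

lemma walk_sum {k : ℕ} (hkn : k + 2 ≤ n) (t : ℕ) : ∑ σ, walk n k t σ = 1 := by
  have h0 := N_pos hkn
  induction t with
  | zero =>
    have hc := cycles_card k hkn
    have hc0 : ((cycles n k).card : ℝ) ≠ 0 := by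
      intro h; rw [h, zero_mul] at hc
      exact (Nat.factorial_ne_zero n) (by exact_mod_cast hc.symm)
    rw [walk_zero]
    simp only [unifOn]
    rw [Finset.sum_ite_mem, Finset.univ_inter, Finset.sum_const, nsmul_eq_mul, one_div,
      mul_inv_cancel₀ hc0]
  | succ t ih =>
    have h := walk_expect k t (by omega) (fun _ : Perm (Fin n) => (1 : ℝ))
    simp only [mul_one, Finset.sum_const, nsmul_eq_mul] at h
    rw [← Finset.sum_mul, ih, offDiag_card_real] at h
    exact mul_left_cancel₀ h0.ne' (by rw [h]; ring)

lemma walk_nonneg (k t : ℕ) (σ : Perm (Fin n)) : 0 ≤ walk n k t σ := by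
  have hu : ∀ (S : Finset (Perm (Fin n))) g, 0 ≤ unifOn S g := by
    intro S g; rw [unifOn]; split_ifs <;> positivity
  have hc : ∀ (a b : Perm (Fin n) → ℝ), (∀ g, 0 ≤ a g) → (∀ g, 0 ≤ b g) → ∀ g, 0 ≤ conv a b g :=
    fun a b ha hb g => Finset.sum_nonneg fun h _ => mul_nonneg (ha _) (hb _)
  induction t generalizing σ with
  | zero => rw [walk_zero]; exact hu _ _
  | succ t ih => rw [walk_succ_conv]; exact hc _ _ ih (hu _) _

/-- sign weight -/
noncomputable def wt (n k t : ℕ) (σ : Perm (Fin n)) : ℝ :=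
  1 + (-1) ^ (t + n - k - 1) * ((Perm.sign σ : ℤ) : ℝ)

lemma sign_real (σ : Perm (Fin n)) : ((Perm.sign σ : ℤ) : ℝ) = 1 ∨ ((Perm.sign σ : ℤ) : ℝ) = -1 := by
  rcases Int.units_eq_one_or (Perm.sign σ) with h | h <;> simp [h]

lemma wt_nonneg (k t : ℕ) (σ : Perm (Fin n)) : 0 ≤ wt n k t σ := by
  rw [wt]
  rcases neg_one_pow_eq_or ℝ (t + n - k - 1) with h | h <;> rcases sign_real σ with h' | h' <;>
    rw [h, h'] <;> norm_num

lemma sign_sum (A : Finset (Fin n)) (hA : 2 ≤ Aᶜ.card) :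
    ∑ σ ∈ HH A, ((Perm.sign σ : ℤ) : ℝ) = 0 := by
  have h := uu_orth A (i := 0) (j := Aᶜ.card - 1) (by omega) (by omega)
  have h2 : ∑ σ ∈ HH A, uu A.card 0 σ * uu A.card (Aᶜ.card - 1) σ =
      (-1) ^ (Aᶜ.card - 1) * ∑ σ ∈ HH A, ((Perm.sign σ : ℤ) : ℝ) := by
    rw [Finset.mul_sum]
    refine Finset.sum_congr rfl fun σ hσ => ?_
    rw [uu_zero, one_mul, uu_top σ A (mem_HH.1 hσ) (by omega)]
  rw [h2] at h
  rcases mul_eq_zero.1 h with h | h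
  · exact absurd h (pow_ne_zero _ (by norm_num))
  · exact h

lemma wt_sum (k t : ℕ) (A : Finset (Fin n)) (hA : 2 ≤ Aᶜ.card) :
    ∑ σ ∈ HH A, wt n k t σ = (Aᶜ.card).factorial := by
  simp only [wt]
  rw [Finset.sum_add_distrib, ← Finset.mul_sum, sign_sum A hA, Finset.sum_const, HH_card]
  simp

lemma stationary_eq {k : ℕ} (t : ℕ) (hkn : k + 2 ≤ n) (σ : Perm (Fin n)) :
    stationary n k (t + 1) σ = wt n k t σ / n.factorial := by
  have hs := sign_sum (∅ : Finset (Fin n)) (by simp; omega)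
  rw [HH_empty] at hs
  have hf : (n.factorial : ℝ) ≠ 0 := by exact_mod_cast n.factorial_ne_zero
  have hev : ((evenPerms n).card : ℝ) = n.factorial / 2 := by
    have : ∑ σ : Perm (Fin n), (1 + ((Perm.sign σ : ℤ) : ℝ)) = 2 * (evenPerms n).card := by
      rw [evenPerms, Finset.card_filter]
      push_cast
      rw [Finset.mul_sum]
      refine Finset.sum_congr rfl fun σ _ => ?_
      rcases Int.units_eq_one_or (Perm.sign σ) with h | h <;> simp [h] <;> norm_num
    rw [Finset.sum_add_distrib, hs] at this
    simp [Fintype.card_perm] at this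
    linarith
  have hod : ((oddPerms n).card : ℝ) = n.factorial / 2 := by
    have : ∑ σ : Perm (Fin n), (1 - ((Perm.sign σ : ℤ) : ℝ)) = 2 * (oddPerms n).card := by
      rw [oddPerms, Finset.card_filter]
      push_cast
      rw [Finset.mul_sum]
      refine Finset.sum_congr rfl fun σ _ => ?_
      rcases Int.units_eq_one_or (Perm.sign σ) with h | h <;> simp [h] <;> norm_num
    rw [Finset.sum_sub_distrib, hs] at this
    simp [Fintype.card_perm] at this
    linarith
  rw [stationary, wt]
  split_ifs with h
  · have hp : Even (t + n - k - 1) := by rw [Nat.even_iff]; omega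
    rw [hp.neg_one_pow, unifOn, evenPerms]
    rw [evenPerms] at hev
    rcases Int.units_eq_one_or (Perm.sign σ) with h | h <;> simp [h, hev]
    norm_num
  · have hp : Odd (t + n - k - 1) := by rw [Nat.odd_iff]; omega
    rw [hp.neg_one_pow, unifOn, oddPerms]
    rw [oddPerms] at hod
    rcases Int.units_eq_one_or (Perm.sign σ) with h | h <;> simp [h, hod]
    norm_num

lemma fix_expand (σ : Perm (Fin n)) : ((fixset σ).card : ℝ) = ∑ x, if σ x = x then (1 : ℝ) else 0 := by
  rw [fixset, Finset.card_filter]; push_cast; rfl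

lemma sum_if_HH (F : Perm (Fin n) → ℝ) (A : Finset (Fin n)) [DecidablePred fun σ : Perm (Fin n) => ∀ x ∈ A, σ x = x] :
    ∑ σ, (if ∀ x ∈ A, σ x = x then F σ else 0) = ∑ σ ∈ HH A, F σ := by
  rw [← Finset.sum_filter]
  refine Finset.sum_congr ?_ fun _ _ => rfl
  ext σ; simp [mem_HH]

lemma wt_tot (k t : ℕ) (hn : 4 ≤ n) : ∑ σ, wt n k t σ = n.factorial := by
  have := wt_sum k t (∅ : Finset (Fin n)) (by simp; omega)
  rw [HH_empty] at this
  simpa using this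

lemma wt_fix (k t : ℕ) (hn : 4 ≤ n) :
    ∑ σ, wt n k t σ * ((fixset σ).card : ℝ) = n.factorial := by
  simp only [fix_expand, Finset.mul_sum]
  rw [Finset.sum_comm]
  have : ∀ x : Fin n, ∑ σ, wt n k t σ * (if σ x = x then (1 : ℝ) else 0) = (n - 1).factorial := by
    intro x
    have h := wt_sum k t ({x} : Finset (Fin n)) (by simp [Finset.card_compl]; omega)
    rw [← sum_if_HH] at h
    simpa [Finset.card_compl] using h
  rw [Finset.sum_congr rfl fun x _ => this x]
  simp
  exact_mod_cast Nat.mul_factorial_pred (by omega)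

lemma wt_fix2 (k t : ℕ) (hn : 4 ≤ n) :
    ∑ σ, wt n k t σ * ((fixset σ).card : ℝ) ^ 2 = 2 * n.factorial := by
  have e0 : ∀ σ : Perm (Fin n), wt n k t σ * ((fixset σ).card : ℝ) ^ 2 =
      ∑ x, ∑ y, wt n k t σ * (if σ x = x ∧ σ y = y then (1 : ℝ) else 0) := by
    intro σ
    rw [sq, fix_expand, Finset.sum_mul_sum, Finset.mul_sum]
    refine Finset.sum_congr rfl fun x _ => ?_
    rw [Finset.mul_sum]
    refine Finset.sum_congr rfl fun y _ => ?_
    by_cases h1 : σ x = x <;> by_cases h2 : σ y = y <;> simp [h1, h2]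
  rw [Finset.sum_congr rfl fun σ _ => e0 σ, Finset.sum_comm]
  have h1 : ∀ x : Fin n, ∑ σ, ∑ y, wt n k t σ * (if σ x = x ∧ σ y = y then (1 : ℝ) else 0) =
      (n - 1).factorial + (n - 1) * (n - 2).factorial := by
    intro x
    rw [Finset.sum_comm, ← Finset.add_sum_erase _ _ (Finset.mem_univ x)]
    congr 1
    · have h := wt_sum k t ({x} : Finset (Fin n)) (by simp [Finset.card_compl]; omega)
      rw [← sum_if_HH] at h
      simpa [Finset.card_compl] using h
    · have : ∀ y ∈ univ.erase x, ∑ σ, wt n k t σ * (if σ x = x ∧ σ y = y then (1 : ℝ) else 0) =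
          (n - 2).factorial := by
        intro y hy
        have hxy : x ≠ y := (Finset.ne_of_mem_erase hy).symm
        have hc : ({x, y} : Finset (Fin n)).card = 2 := Finset.card_pair hxy
        have h := wt_sum k t ({x, y} : Finset (Fin n)) (by rw [Finset.card_compl, hc]; simp; omega)
        rw [← sum_if_HH, Finset.card_compl, hc, Fintype.card_fin] at h
        simpa using h
      rw [Finset.sum_congr rfl this, Finset.sum_const, Finset.card_erase_of_mem (mem_univ _)]
      simp
      left
      rw [Nat.cast_sub (by omega)]; simp
  rw [Finset.sum_congr rfl fun x _ => h1 x]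
  simp
  have a1 : n * (n - 1).factorial = n.factorial := Nat.mul_factorial_pred (by omega)
  have a2 : (n - 1) * (n - 2).factorial = (n - 1).factorial := by
    have := Nat.mul_factorial_pred (n := n - 1) (by omega)
    rwa [show n - 1 - 1 = n - 2 by omega] at this
  have a3 : ((n : ℝ) - 1) * ((n - 2).factorial : ℝ) = (n - 1).factorial := by
    rw [← a2]; push_cast; rw [Nat.cast_sub (by omega)]; simp
  rw [a3, ← a1]; push_cast; ring

lemma tv_eq (μ ν : Perm (Fin n) → ℝ) (h : ∑ σ, μ σ = ∑ σ, ν σ) :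
    tvDist μ ν = ∑ σ, max (ν σ - μ σ) 0 := by
  have e : ∀ σ, |μ σ - ν σ| = 2 * max (ν σ - μ σ) 0 + (μ σ - ν σ) := by
    intro σ
    rcases le_total (μ σ) (ν σ) with h | h
    · rw [abs_of_nonpos (by linarith), max_eq_left (by linarith)]; ring
    · rw [abs_of_nonneg (by linarith), max_eq_right (by linarith)]; ring
  rw [tvDist, Finset.sum_congr rfl fun σ _ => e σ, Finset.sum_add_distrib, ← Finset.mul_sum,
    Finset.sum_sub_distrib, h]; ring

lemma stationary_sum {k : ℕ} (t : ℕ) (hn : 4 ≤ n) (hkn : k + 2 ≤ n) :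
    ∑ σ : Perm (Fin n), stationary n k (t + 1) σ = 1 := by
  rw [Finset.sum_congr rfl fun σ _ => stationary_eq t hkn σ, ← Finset.sum_div, wt_tot k t hn]
  exact div_self (by exact_mod_cast n.factorial_ne_zero)

lemma tv_nonneg (μ ν : Perm (Fin n) → ℝ) : 0 ≤ tvDist μ ν := by
  rw [tvDist]; exact mul_nonneg (by norm_num) (Finset.sum_nonneg fun _ _ => abs_nonneg _)

lemma tv_le_one {k : ℕ} (t : ℕ) (hn : 4 ≤ n) (hkn : k + 2 ≤ n) :
    tvDist (walk n k t) (stationary n k (t + 1)) ≤ 1 := by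
  rw [tv_eq _ _ (by rw [walk_sum hkn, stationary_sum t hn hkn]), ← stationary_sum t hn hkn]
  refine Finset.sum_le_sum fun σ _ => ?_
  have h1 := walk_nonneg k t σ
  have h2 : 0 ≤ stationary n k (t + 1) σ := by
    rw [stationary_eq t hkn]; exact div_nonneg (wt_nonneg _ _ _) (Nat.cast_nonneg _)
  exact max_le (by linarith) h2

/-- error part -/
noncomputable def EE (n k t : ℕ) (A : Finset (Fin n)) (σ : Perm (Fin n)) : ℝ :=
  ∑ j ∈ Finset.Ico 1 (n - A.card - 1), cc n k t A.card j * uu A.card j σ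

lemma yy_split {k : ℕ} (t : ℕ) (hkn : k + 3 ≤ n) (A : Finset (Fin n)) (σ : Perm (Fin n))
    (hAk : A.card ≤ k) (hA : ∀ x ∈ A, σ x = x) :
    yy n k t A σ = cc n k t A.card 0 * wt n k t σ + EE n k t A σ := by
  have hcard : Aᶜ.card = n - A.card := by rw [Finset.card_compl, Fintype.card_fin]
  obtain ⟨m, hm⟩ : ∃ m, n - A.card = m + 2 := ⟨n - A.card - 2, by omega⟩
  have ht := uu_top σ A hA (by omega)
  have hct := cc_top (by omega : k + 2 ≤ n) t A.card hAk
  rw [hcard, hm] at ht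
  rw [hm] at hct
  rw [yy, EE, wt, hm, Finset.sum_range_succ, show m + 2 - 1 = m + 1 by omega,
    Finset.range_eq_Ico, Finset.sum_eq_sum_Ico_succ_bot (by omega)]
  rw [show m + 2 - 1 = m + 1 by omega] at ht hct
  rw [ht, hct, uu_zero]
  have hsgn : ((-1 : ℝ)) ^ (t + k - A.card) * (-1) ^ (m + 1) = (-1) ^ (t + n - k - 1) := by
    rw [← pow_add]
    rcases Nat.even_or_odd (t + n - k - 1) with h | h
    · have : Even (t + k - A.card + (m + 1)) := by
        rw [Nat.even_iff] at *; omega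
      rw [h.neg_one_pow, this.neg_one_pow]
    · have : Odd (t + k - A.card + (m + 1)) := by
        rw [Nat.odd_iff] at *; omega
      rw [h.neg_one_pow, this.neg_one_pow]
  rw [← hsgn]; ring

lemma EE_bound {k : ℕ} (t : ℕ) (hn : 4 ≤ n) (hkn : k + 3 ≤ n) (A : Finset (Fin n))
    (hAk : A.card ≤ k) (Ψ : ℝ) (hΨ : psi n k t A.card ≤ Ψ) (hΨ1 : Ψ < 1) :
    ∑ σ ∈ HH A, max (-EE n k t A σ) 0 ≤
      1 / 2 * (n - A.card).factorial * (cc n k t A.card 0 * √(2 * (Ψ ^ 2 / (1 - Ψ ^ 2)))) := by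
  have hcard : Aᶜ.card = n - A.card := by rw [Finset.card_compl, Fintype.card_fin]
  have h := uu_neg_part A (by omega) (Finset.Ico 1 (n - A.card - 1))
    (by rw [hcard]; intro j; simp; omega) (by simp) (cc n k t A.card)
  rw [hcard] at h
  refine h.trans (mul_le_mul_of_nonneg_left ?_ (by positivity))
  have hs := Real.sqrt_le_sqrt (cc_sq_sum hn hkn t A.card hAk Ψ hΨ hΨ1)
  refine hs.trans (le_of_eq ?_)
  rw [show 2 * cc n k t A.card 0 ^ 2 * (Ψ ^ 2 / (1 - Ψ ^ 2)) =
    cc n k t A.card 0 ^ 2 * (2 * (Ψ ^ 2 / (1 - Ψ ^ 2))) by ring,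
    Real.sqrt_mul (sq_nonneg _), Real.sqrt_sq (PP_nonneg (by omega) t _)]

lemma walk_ge2 {k : ℕ} (t : ℕ) (hkn : k + 2 ≤ n) (σ : Perm (Fin n)) :
    YY n k t ∅ σ + ∑ x ∈ fixset σ, YY n k t {x} σ ≤ walk n k t σ := by
  refine le_trans ?_ (walk_ge k t hkn σ)
  have h1 : ∑ x ∈ fixset σ, YY n k t {x} σ =
      ∑ A ∈ (fixset σ).image (fun x => ({x} : Finset (Fin n))), YY n k t A σ := by
    rw [Finset.sum_image]
    intro x _ y _ h
    exact Finset.singleton_injective h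
  have h2 : (∅ : Finset (Fin n)) ∉ (fixset σ).image (fun x => ({x} : Finset (Fin n))) := by
    simp
  rw [h1, ← Finset.sum_insert (f := fun A => YY n k t A σ) h2]
  apply Finset.sum_le_sum_of_subset_of_nonneg
  · intro A hA
    rw [Finset.mem_insert, Finset.mem_image] at hA
    rw [Finset.mem_powerset]
    rcases hA with rfl | ⟨x, hx, rfl⟩
    · simp
    · simpa using hx
  · intro A hA _
    exact YY_nonneg k t hkn A σ (subset_fixset.1 (Finset.mem_powerset.1 hA))

lemma point_bound {k : ℕ} (t : ℕ) (hk : 1 ≤ k) (hkn : k + 3 ≤ n) (σ : Perm (Fin n)) :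
    max (stationary n k (t + 1) σ - walk n k t σ) 0 ≤
      (n.factorial : ℝ)⁻¹ * (wt n k t σ * ((1 - cc n k t 0 0 - cc n k t 1 0) +
        cc n k t 1 0 * ((2 - 3 * ((fixset σ).card : ℝ) + ((fixset σ).card : ℝ) ^ 2) / 2)) +
        max (-EE n k t ∅ σ) 0 +
        ∑ x, if σ x = x then max (-EE n k t {x} σ) 0 else 0) := by
  have hP0 := PP_nonneg (by omega : k + 2 ≤ n) t 0
  have hP1 := PP_nonneg (by omega : k + 2 ≤ n) t 1
  have hPs : cc n k t 0 0 + cc n k t 1 0 ≤ 1 := by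
    refine le_trans ?_ (PP_sum_le (by omega : k + 2 ≤ n) t)
    have : ∑ a ∈ range 2, cc n k t a 0 ≤ ∑ a ∈ range (k + 1), cc n k t a 0 :=
      Finset.sum_le_sum_of_subset_of_nonneg (Finset.range_subset_range.2 (by omega))
        fun a _ _ => PP_nonneg (by omega) t a
    simpa [Finset.sum_range_succ] using this
  have hw := wt_nonneg k t σ
  have hf : (0 : ℝ) < n.factorial := by exact_mod_cast n.factorial_pos
  set f : ℝ := ((fixset σ).card : ℝ) with hfdef
  have hquad : max (1 - f) 0 ≤ (2 - 3 * f + f ^ 2) / 2 := by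
    rcases Nat.lt_or_ge (fixset σ).card 1 with h | h
    · have : (fixset σ).card = 0 := by omega
      rw [hfdef, this]; simp
    · rcases Nat.lt_or_ge (fixset σ).card 2 with h' | h'
      · have : (fixset σ).card = 1 := by omega
        rw [hfdef, this]; norm_num
      · have : (2 : ℝ) ≤ f := by rw [hfdef]; exact_mod_cast h'
        rw [max_eq_right (by linarith)]
        nlinarith
  have hge := walk_ge2 t (by omega : k + 2 ≤ n) σ
  have y0 : YY n k t ∅ σ = (n.factorial : ℝ)⁻¹ * (cc n k t 0 0 * wt n k t σ + EE n k t ∅ σ) := by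
    rw [YY, yy_split t hkn ∅ σ (by simp) (by simp)]; simp
  have y1 : ∀ x ∈ fixset σ, YY n k t {x} σ =
      (n.factorial : ℝ)⁻¹ * (cc n k t 1 0 * wt n k t σ + EE n k t {x} σ) := by
    intro x hx
    have hx' : σ x = x := by simpa [fixset] using hx
    rw [YY, yy_split t hkn {x} σ (by simpa using hk) (by simpa using hx')]; simp
  rw [y0, Finset.sum_congr rfl y1, ← Finset.mul_sum, Finset.sum_add_distrib, Finset.sum_const,
    nsmul_eq_mul, ← hfdef] at hge
  have hE : ∑ x ∈ fixset σ, -EE n k t {x} σ ≤ ∑ x, if σ x = x then max (-EE n k t {x} σ) 0 else 0 := by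
    rw [← Finset.sum_filter]
    exact Finset.sum_le_sum fun x _ => le_max_left _ _
  rw [Finset.sum_neg_distrib] at hE
  have hE0 : 0 ≤ ∑ x, if σ x = x then max (-EE n k t {x} σ) 0 else 0 :=
    Finset.sum_nonneg fun x _ => by split_ifs <;> simp
  have hEe := le_max_left (-EE n k t ∅ σ) 0
  have hEe0 := le_max_right (-EE n k t ∅ σ) 0
  have hm1 := le_max_left (1 - f) 0
  have hm0 := le_max_right (1 - f) 0
  have hbr : 0 ≤ (1 - cc n k t 0 0 - cc n k t 1 0) + cc n k t 1 0 * ((2 - 3 * f + f ^ 2) / 2) :=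
    add_nonneg (by linarith) (mul_nonneg hP1 (hm0.trans hquad))
  apply max_le
  · rw [stationary_eq t (by omega), div_eq_inv_mul]
    have h1 : wt n k t σ * (1 - cc n k t 0 0 - cc n k t 1 0 * f) ≤
        wt n k t σ * ((1 - cc n k t 0 0 - cc n k t 1 0) + cc n k t 1 0 * ((2 - 3 * f + f ^ 2) / 2)) := by
      apply mul_le_mul_of_nonneg_left _ hw
      have := mul_le_mul_of_nonneg_left (hm1.trans hquad) hP1
      linarith
    have h2 : (n.factorial : ℝ)⁻¹ * (wt n k t σ * (1 - cc n k t 0 0 - cc n k t 1 0 * f) +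
        max (-EE n k t ∅ σ) 0 + ∑ x, if σ x = x then max (-EE n k t {x} σ) 0 else 0) ≤ _ :=
      mul_le_mul_of_nonneg_left (add_le_add_left (add_le_add_left h1 _) _) (inv_nonneg.2 hf.le)
    refine le_trans ?_ h2
    have h3 : (n.factorial : ℝ)⁻¹ * (wt n k t σ * (1 - cc n k t 0 0 - cc n k t 1 0 * f) +
        (-EE n k t ∅ σ) + -∑ x ∈ fixset σ, EE n k t {x} σ) ≤ _ :=
      mul_le_mul_of_nonneg_left (add_le_add (add_le_add_right hEe _) hE) (inv_nonneg.2 hf.le)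
    refine le_trans ?_ h3
    linarith
  · apply mul_nonneg (inv_nonneg.2 hf.le)
    have := mul_nonneg hw hbr
    linarith

lemma tv_upper {k : ℕ} (t : ℕ) (hk : 1 ≤ k) (hkn : k + 3 ≤ n) (hΨ1 : psi n k t 0 < 1) :
    tvDist (walk n k t) (stationary n k (t + 1)) ≤
      t * (k : ℝ) ^ 2 / (n * (n - 1)) + 1 / 2 * (k * (1 - 2 / (n : ℝ)) ^ t) +
      1 / 2 * √(2 * (psi n k t 0 ^ 2 / (1 - psi n k t 0 ^ 2))) := by
  have hn : 4 ≤ n := by omega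
  have hf : (0 : ℝ) < n.factorial := by exact_mod_cast n.factorial_pos
  have hPn := fun a => PP_nonneg (by omega : k + 2 ≤ n) t a
  have hk2 : k + 2 ≤ n := by omega
  set Ψ := psi n k t 0 with hΨ
  have hΨ' : psi n k t 1 ≤ Ψ := by
    have hk3 : (k : ℝ) + 3 ≤ n := by exact_mod_cast hkn
    have h4 : (4 : ℝ) ≤ n := by exact_mod_cast hn
    have hr : (0 : ℝ) ≤ 1 - 2 / ((n : ℝ) - 1) := by
      rw [sub_nonneg, div_le_one (by linarith)]; linarith
    have hr1 : 1 - 2 / ((n : ℝ) - 1) ≤ 1 := by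
      have : (0 : ℝ) ≤ 2 / ((n : ℝ) - 1) := div_nonneg (by norm_num) (by linarith)
      linarith
    rw [hΨ, psi, psi]
    apply add_le_add
    · apply div_le_div_of_nonneg_right _ (by positivity)
      exact pow_le_pow_of_le_one hr hr1 (by omega)
    · apply div_le_div_of_nonneg_right _ (by linarith)
      simp
  set S := √(2 * (Ψ ^ 2 / (1 - Ψ ^ 2))) with hS
  have hS0 : 0 ≤ S := Real.sqrt_nonneg _
  rw [tv_eq _ _ (by rw [walk_sum hk2, stationary_sum t hn hk2])]
  refine (Finset.sum_le_sum fun σ _ => point_bound t hk hkn σ).trans ?_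
  rw [← Finset.mul_sum, Finset.sum_add_distrib, Finset.sum_add_distrib]
  have s1 : ∑ σ, wt n k t σ * ((1 - cc n k t 0 0 - cc n k t 1 0) +
        cc n k t 1 0 * ((2 - 3 * ((fixset σ).card : ℝ) + ((fixset σ).card : ℝ) ^ 2) / 2)) =
      n.factorial * ((1 - cc n k t 0 0 - cc n k t 1 0) + cc n k t 1 0 / 2) := by
    have e : ∀ σ : Perm (Fin n), wt n k t σ * ((1 - cc n k t 0 0 - cc n k t 1 0) +
        cc n k t 1 0 * ((2 - 3 * ((fixset σ).card : ℝ) + ((fixset σ).card : ℝ) ^ 2) / 2)) =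
        (1 - cc n k t 0 0 - cc n k t 1 0 + cc n k t 1 0) * wt n k t σ +
        (-(3 / 2) * cc n k t 1 0) * (wt n k t σ * ((fixset σ).card : ℝ)) +
        (cc n k t 1 0 / 2) * (wt n k t σ * ((fixset σ).card : ℝ) ^ 2) := by
      intro σ; ring
    rw [Finset.sum_congr rfl fun σ _ => e σ, Finset.sum_add_distrib, Finset.sum_add_distrib,
      ← Finset.mul_sum, ← Finset.mul_sum, ← Finset.mul_sum, wt_tot k t hn, wt_fix k t hn,
      wt_fix2 k t hn]
    ring
  have s2 : ∑ σ, max (-EE n k t ∅ σ) 0 ≤ n.factorial * (1 / 2 * cc n k t 0 0 * S) := by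
    have h := EE_bound t hn hkn (∅ : Finset (Fin n)) (by simp) Ψ (by simp [hΨ]) hΨ1
    rw [HH_empty] at h
    refine h.trans (le_of_eq ?_)
    simp only [Finset.card_empty, Nat.sub_zero]
    ring
  have s3 : ∑ σ : Perm (Fin n), ∑ x, (if σ x = x then max (-EE n k t {x} σ) 0 else 0) ≤
      n.factorial * (1 / 2 * cc n k t 1 0 * S) := by
    rw [Finset.sum_comm]
    have h : ∀ x ∈ (univ : Finset (Fin n)), ∑ σ : Perm (Fin n),
        (if σ x = x then max (-EE n k t {x} σ) 0 else 0) ≤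
        1 / 2 * (n - 1).factorial * (cc n k t 1 0 * S) := by
      intro x _
      have h := EE_bound t hn hkn ({x} : Finset (Fin n)) (by simpa using hk) Ψ (by simpa using hΨ') hΨ1
      rw [← sum_if_HH, ← hS] at h
      simpa using h
    refine (Finset.sum_le_sum h).trans (le_of_eq ?_)
    rw [Finset.sum_const, Finset.card_univ, Fintype.card_fin, nsmul_eq_mul]
    have a1 : n * (n - 1).factorial = n.factorial := Nat.mul_factorial_pred (by omega)
    rw [← a1]; push_cast; ring
  rw [s1]
  have hsum : (n.factorial : ℝ)⁻¹ * (n.factorial * ((1 - cc n k t 0 0 - cc n k t 1 0) + cc n k t 1 0 / 2) +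
      ∑ σ, max (-EE n k t ∅ σ) 0 +
      ∑ σ : Perm (Fin n), ∑ x, (if σ x = x then max (-EE n k t {x} σ) 0 else 0)) ≤
      ((1 - cc n k t 0 0 - cc n k t 1 0) + cc n k t 1 0 / 2) + 1 / 2 * cc n k t 0 0 * S +
        1 / 2 * cc n k t 1 0 * S := by
    rw [inv_mul_le_iff₀ hf]
    linarith
  refine hsum.trans ?_
  have hPs : cc n k t 0 0 + cc n k t 1 0 ≤ 1 := by
    refine le_trans ?_ (PP_sum_le hk2 t)
    have : ∑ a ∈ range 2, cc n k t a 0 ≤ ∑ a ∈ range (k + 1), cc n k t a 0 :=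
      Finset.sum_le_sum_of_subset_of_nonneg (Finset.range_subset_range.2 (by omega))
        fun a _ _ => hPn a
    simpa [Finset.sum_range_succ] using this
  have hge := PP_sum_ge hk2 t
  have hM := PM_le hk2 t
  have hmix : ∑ a ∈ range (k + 1), cc n k t a 0 - 1 / 2 * ∑ a ∈ range (k + 1), (a : ℝ) * cc n k t a 0 ≤
      cc n k t 0 0 + cc n k t 1 0 / 2 := by
    rw [Finset.mul_sum, ← Finset.sum_sub_distrib, show k + 1 = (k - 1) + 1 + 1 by omega,
      Finset.sum_range_succ', Finset.sum_range_succ']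
    have : ∑ i ∈ range (k - 1), (cc n k t (i + 1 + 1) 0 -
        1 / 2 * (((i + 1 + 1 : ℕ) : ℝ) * cc n k t (i + 1 + 1) 0)) ≤ 0 := by
      apply Finset.sum_nonpos
      intro i _
      have := hPn (i + 1 + 1)
      have : 0 ≤ (i : ℝ) * cc n k t (i + 1 + 1) 0 := by positivity
      push_cast
      linarith
    push_cast at this ⊢
    norm_num at this ⊢
    linarith
  have hS2 : (cc n k t 0 0 + cc n k t 1 0) * S ≤ 1 * S := mul_le_mul_of_nonneg_right hPs hS0
  linarith

end tv
end HookWalk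

open Finset Filter Real

namespace HookWalk
open Equiv

section moments
variable {n : ℕ}

/-- real permutation matrix -/
noncomputable def PR (σ : Perm (Fin n)) : Matrix (Fin n) (Fin n) ℝ :=
  fun i j => if i = σ j then 1 else 0

lemma PR_mul (σ τ : Perm (Fin n)) : PR (σ * τ) = PR σ * PR τ := by
  refine Matrix.ext fun i j => ?_
  rw [Matrix.mul_apply, Finset.sum_eq_single (τ j)]
  · by_cases h : i = σ (τ j)
    · simp [PR, h]
    · simp [PR, h]
  · intro b _ hb
    simp [PR, hb]
  · simp

/-- fixed points -/
noncomputable def ff (σ : Perm (Fin n)) : ℝ := (fixset σ).card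

lemma PR_trace (σ : Perm (Fin n)) : (PR σ).trace = ff σ := by
  rw [ff, fix_expand, Matrix.trace]
  refine Finset.sum_congr rfl fun x _ => ?_
  simp [PR, eq_comm]

/-- quadratic form at `e_x - e_y` -/
noncomputable def DD (M : Matrix (Fin n) (Fin n) ℝ) (x y : Fin n) : ℝ :=
  M x x + M y y - M x y - M y x

lemma PR_swap (x y : Fin n) (hxy : x ≠ y) : ∃ v : Fin n → ℝ,
    PR (swap x y) = 1 - Matrix.vecMulVec v v ∧
    ∀ M : Matrix (Fin n) (Fin n) ℝ, v ⬝ᵥ M.mulVec v = DD M x y := by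
  refine ⟨Pi.single x 1 - Pi.single y 1, ?_, ?_⟩
  · ext i j
    simp only [PR, Matrix.sub_apply, Matrix.one_apply, Matrix.vecMulVec_apply, Pi.sub_apply,
      Pi.single_apply, swap_apply_def]
    by_cases h1 : i = x <;> by_cases h2 : i = y <;> by_cases h3 : j = x <;> by_cases h4 : j = y <;>
      simp_all
  · intro M
    simp [Matrix.mulVec_sub, sub_dotProduct, dotProduct_sub, DD]
    ring

lemma ff_swap (σ : Perm (Fin n)) (x y : Fin n) :
    ff (σ * swap x y) = ff σ - DD (PR σ) x y := by
  by_cases hxy : x = y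
  · subst hxy; simp [DD, ← Perm.one_def]
  obtain ⟨v, h1, h2⟩ := PR_swap x y hxy
  rw [← PR_trace, ← PR_trace, PR_mul, h1, mul_sub, mul_one, Matrix.trace_sub, ← h2,
    Matrix.mul_vecMulVec, Matrix.trace_vecMulVec, dotProduct_comm]

lemma ss_swap (σ : Perm (Fin n)) (x y : Fin n) :
    ff ((σ * swap x y) * (σ * swap x y)) =
      ff (σ * σ) - 2 * DD (PR (σ * σ)) x y + DD (PR σ) x y ^ 2 := by
  by_cases hxy : x = y
  · subst hxy; simp [DD, ← Perm.one_def]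
  obtain ⟨v, h1, h2⟩ := PR_swap x y hxy
  rw [← PR_trace, ← PR_trace, PR_mul, PR_mul σ (swap x y), h1, PR_mul σ σ, ← h2, ← h2]
  set P := PR σ
  set V := Matrix.vecMulVec v v with hV
  have e : P * (1 - V) * (P * (1 - V)) = P * P - P * P * V - P * V * P + P * V * (P * V) := by
    noncomm_ring
  have t1 : (P * P * V).trace = v ⬝ᵥ (P * P).mulVec v := by
    rw [hV, Matrix.mul_vecMulVec, Matrix.trace_vecMulVec, dotProduct_comm]
  have t2 : (P * V * P).trace = v ⬝ᵥ (P * P).mulVec v := by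
    rw [← t1, Matrix.trace_mul_comm, ← mul_assoc]
  have t3 : (P * V * (P * V)).trace = (v ⬝ᵥ P.mulVec v) ^ 2 := by
    rw [hV, Matrix.mul_vecMulVec, Matrix.vecMulVec_mul_vecMulVec, Matrix.trace_vecMulVec]
    simp only [dotProduct_smul, smul_eq_mul]
    rw [dotProduct_comm (P.mulVec v) v]; ring
  rw [e, Matrix.trace_add, Matrix.trace_sub, Matrix.trace_sub, t1, t2, t3]; ring

lemma PR_col (σ : Perm (Fin n)) (j : Fin n) : ∑ i, PR σ i j = 1 := by simp [PR]

lemma PR_row (σ : Perm (Fin n)) (i : Fin n) : ∑ j, PR σ i j = 1 := by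
  rw [Finset.sum_eq_single (σ⁻¹ i)]
  · simp [PR]
  · intro j _ hj
    simp only [PR]
    rw [if_neg]
    rintro rfl
    simp at hj
  · simp

lemma DD_sum (σ : Perm (Fin n)) : ∑ x, ∑ y, DD (PR σ) x y = 2 * n * ff σ - 2 * n := by
  simp only [DD, Finset.sum_sub_distrib, Finset.sum_add_distrib, PR_row, PR_col, Finset.sum_const,
    Finset.card_univ, Fintype.card_fin, nsmul_eq_mul]
  have := PR_trace σ
  rw [Matrix.trace] at this
  simp only [Matrix.diag_apply] at this
  rw [← Finset.mul_sum, this]; ring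

lemma DD_sq_sum (σ : Perm (Fin n)) : ∑ x, ∑ y, DD (PR σ) x y ^ 2 =
    2 * (n * ff σ + ff σ ^ 2 - 4 * ff σ + n + ff (σ * σ)) := by
  have i1 : ∀ x y, PR σ x y * PR σ x y = PR σ x y := by
    intro x y; simp only [PR]; split_ifs <;> simp
  have e : ∀ x y, DD (PR σ) x y ^ 2 = PR σ x x + PR σ y y + PR σ x y + PR σ y x +
      2 * (PR σ x x * PR σ y y) + 2 * (PR σ x y * PR σ y x) -
      2 * (PR σ x x * PR σ x y) - 2 * (PR σ x x * PR σ y x) -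
      2 * (PR σ x y * PR σ y y) - 2 * (PR σ y x * PR σ y y) := by
    intro x y
    rw [DD]
    linear_combination i1 x x + i1 y y + i1 x y + i1 y x
  have t1 := PR_trace σ
  rw [Matrix.trace] at t1
  simp only [Matrix.diag_apply] at t1
  have t2 := PR_trace (σ * σ)
  rw [PR_mul, Matrix.trace] at t2
  simp only [Matrix.diag_apply, Matrix.mul_apply] at t2
  have c1 : ∑ x, ∑ y, PR σ x y * PR σ y y = ff σ := by
    rw [Finset.sum_comm]; simp only [← Finset.sum_mul, PR_col, one_mul, t1]
  have c2 : ∑ x, ∑ y, PR σ y x * PR σ y y = ff σ := by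
    rw [Finset.sum_comm]; simp only [← Finset.sum_mul, PR_row, one_mul, t1]
  simp only [e, Finset.sum_sub_distrib, Finset.sum_add_distrib, ← Finset.mul_sum, PR_row, PR_col,
    Finset.sum_const, Finset.card_univ, Fintype.card_fin, nsmul_eq_mul, mul_one, t1, t2, c1, c2,
    ← Finset.sum_mul]
  ring

lemma offDiag_sum (F : Perm (Fin n) → ℝ) (σ : Perm (Fin n)) :
    ∑ p ∈ (univ : Finset (Fin n)).offDiag, F (σ * swap p.1 p.2) =
      ∑ x, ∑ y, F (σ * swap x y) - n * F σ := by
  rw [← Finset.sum_product', eq_sub_iff_add_eq, Finset.univ_product_univ]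
  have h := Finset.sum_filter_add_sum_filter_not (univ : Finset (Fin n × Fin n))
    (fun p => p.1 ≠ p.2) (fun p => F (σ * swap p.1 p.2))
  rw [← h]
  congr 1
  · refine Finset.sum_congr ?_ fun _ _ => rfl
    ext p; simp
  · have : ∀ p ∈ univ.filter (fun p : Fin n × Fin n => ¬ p.1 ≠ p.2), F (σ * swap p.1 p.2) = F σ := by
      intro p hp
      simp only [ne_eq, not_not, mem_filter, mem_univ, true_and] at hp
      rw [hp, swap_self, ← Perm.one_def, mul_one]
    rw [Finset.sum_congr rfl this, Finset.sum_const, nsmul_eq_mul]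
    congr 2
    have : univ.filter (fun p : Fin n × Fin n => ¬ p.1 ≠ p.2) = (univ : Finset (Fin n)).diag := by
      ext p; simp
    rw [this, Finset.diag_card]; simp

lemma T_f (σ : Perm (Fin n)) : ∑ p ∈ (univ : Finset (Fin n)).offDiag, ff (σ * swap p.1 p.2) =
    (n * (n - 1) - 2 * n) * ff σ + 2 * n := by
  rw [offDiag_sum]
  simp only [ff_swap, Finset.sum_sub_distrib, DD_sum]
  simp; ring

lemma T_f2 (σ : Perm (Fin n)) : ∑ p ∈ (univ : Finset (Fin n)).offDiag, ff (σ * swap p.1 p.2) ^ 2 =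
    (n * (n - 1) - 4 * n) * ff σ ^ 2 + 4 * n * ff σ +
      2 * (n * ff σ + ff σ ^ 2 - 4 * ff σ + n + ff (σ * σ)) := by
  rw [offDiag_sum (fun σ => ff σ ^ 2)]
  have e : ∀ x y, ff (σ * swap x y) ^ 2 = ff σ ^ 2 - 2 * ff σ * DD (PR σ) x y + DD (PR σ) x y ^ 2 := by
    intro x y; rw [ff_swap]; ring
  simp only [e, Finset.sum_sub_distrib, Finset.sum_add_distrib, ← Finset.mul_sum, DD_sum, DD_sq_sum]
  simp; ring

lemma T_s (σ : Perm (Fin n)) : ∑ p ∈ (univ : Finset (Fin n)).offDiag,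
      ff ((σ * swap p.1 p.2) * (σ * swap p.1 p.2)) =
    (n * (n - 1) - 4 * n) * ff (σ * σ) + 4 * n +
      2 * (n * ff σ + ff σ ^ 2 - 4 * ff σ + n + ff (σ * σ)) := by
  rw [offDiag_sum (fun σ => ff (σ * σ))]
  simp only [ss_swap, Finset.sum_sub_distrib, Finset.sum_add_distrib, ← Finset.mul_sum, DD_sum,
    DD_sq_sum]
  simp; ring

lemma eigen_walk {k : ℕ} (hkn : k + 2 ≤ n) (F : Perm (Fin n) → ℝ) (lam F0 : ℝ)
    (hF : ∀ σ, ∑ p ∈ (univ : Finset (Fin n)).offDiag, F (σ * swap p.1 p.2) =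
      n * (n - 1) * lam * F σ)
    (hF0 : ∀ σ ∈ cycles n k, F σ = F0) (t : ℕ) :
    ∑ σ, walk n k t σ * F σ = F0 * lam ^ t := by
  have h0 := N_pos hkn
  induction t with
  | zero =>
    have h1 := walk_sum hkn 0
    rw [pow_zero, mul_one]
    calc ∑ σ, walk n k 0 σ * F σ = ∑ σ, walk n k 0 σ * F0 := by
          refine Finset.sum_congr rfl fun σ _ => ?_
          by_cases h : σ ∈ cycles n k
          · rw [hF0 σ h]
          · rw [walk_zero, unifOn, if_neg h]; simp
      _ = F0 := by rw [← Finset.sum_mul, h1, one_mul]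
  | succ t ih =>
    have h := walk_expect k t (by omega) F
    simp only [hF] at h
    have e : ∀ σ, walk n k t σ * (n * (n - 1) * lam * F σ) =
      (n * (n - 1) * lam) * (walk n k t σ * F σ) := fun σ => by ring
    rw [Finset.sum_congr rfl fun σ _ => e σ, ← Finset.mul_sum, ih] at h
    apply mul_left_cancel₀ h0.ne'
    rw [h, pow_succ]; ring

lemma ff_cycle {k : ℕ} (hkn : k + 3 ≤ n) (σ : Perm (Fin n)) (hσ : σ ∈ cycles n k) :
    ff σ = k ∧ ff (σ * σ) = k := by
  rw [mem_cycles] at hσ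
  have h1 : (fixset σ).card = k := by
    have := hσ.2
    rw [support_compl_fixset, Finset.card_compl, Fintype.card_fin] at this
    have h2 : (fixset σ).card ≤ n := by simpa using Finset.card_le_univ (fixset σ)
    omega
  have h2 : fixset (σ * σ) = fixset σ := by
    ext x
    have m1 : x ∈ fixset (σ * σ) ↔ σ (σ x) = x := by
      rw [fixset, Finset.mem_filter]; simp
    have m2 : x ∈ fixset σ ↔ σ x = x := by simp [fixset]
    rw [m1, m2]
    constructor
    · intro h
      by_contra hx
      have := (hσ.1.pow_eq_one_iff (n := 2)).2 ⟨x, hx, by simpa [sq] using h⟩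
      have h3 := orderOf_dvd_of_pow_eq_one this
      rw [hσ.1.orderOf, hσ.2] at h3
      have := Nat.le_of_dvd (by norm_num) h3
      omega
    · intro h; rw [h, h]
  rw [ff, ff, h2, h1]; simp

lemma walk_f {k : ℕ} (hkn : k + 3 ≤ n) (t : ℕ) :
    ∑ σ, walk n k t σ * (ff σ - 1) = (k - 1) * (1 - 2 / ((n : ℝ) - 1)) ^ t := by
  have hn : (3 : ℝ) ≤ n := by exact_mod_cast (by omega : 3 ≤ n)
  have hn1 : (n : ℝ) - 1 ≠ 0 := by linarith
  refine eigen_walk (by omega) (fun σ => ff σ - 1) _ _ ?_ ?_ t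
  · intro σ
    rw [Finset.sum_sub_distrib, T_f, Finset.sum_const, nsmul_eq_mul, offDiag_card_real]
    field_simp; ring
  · intro σ hσ; simp only [(ff_cycle hkn σ hσ).1]

lemma walk_h {k : ℕ} (hkn : k + 3 ≤ n) (t : ℕ) :
    ∑ σ, walk n k t σ * (ff σ ^ 2 - ff (σ * σ) - 2 * ff σ + 2) =
      (k - 1) * (k - 2) * (1 - 4 / ((n : ℝ) - 1)) ^ t := by
  have hn : (3 : ℝ) ≤ n := by exact_mod_cast (by omega : 3 ≤ n)
  have hn1 : (n : ℝ) - 1 ≠ 0 := by linarith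
  refine eigen_walk (by omega) (fun σ => ff σ ^ 2 - ff (σ * σ) - 2 * ff σ + 2) _ _ ?_ ?_ t
  · intro σ
    rw [Finset.sum_add_distrib, Finset.sum_sub_distrib, Finset.sum_sub_distrib, ← Finset.mul_sum,
      T_f, T_f2, T_s, Finset.sum_const, nsmul_eq_mul, offDiag_card_real]
    field_simp; ring
  · intro σ hσ
    obtain ⟨h1, h2⟩ := ff_cycle hkn σ hσ
    simp only [h1, h2]; ring

lemma walk_g {k : ℕ} (hkn : k + 3 ≤ n) (t : ℕ) :
    ∑ σ, walk n k t σ * (ff σ ^ 2 + ff (σ * σ) - 4 * ff σ) =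
      (k ^ 2 - 3 * k) * (1 - 4 / (n : ℝ)) ^ t := by
  have hn : (3 : ℝ) ≤ n := by exact_mod_cast (by omega : 3 ≤ n)
  have hn1 : (n : ℝ) ≠ 0 := by linarith
  refine eigen_walk (by omega) (fun σ => ff σ ^ 2 + ff (σ * σ) - 4 * ff σ) _ _ ?_ ?_ t
  · intro σ
    rw [Finset.sum_sub_distrib, Finset.sum_add_distrib, ← Finset.mul_sum,
      T_f, T_f2, T_s]
    field_simp; ring
  · intro σ hσ
    obtain ⟨h1, h2⟩ := ff_cycle hkn σ hσ
    simp only [h1, h2]; ring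

/-- variance of the walk -/
noncomputable def VV (n k t : ℕ) : ℝ :=
  1 / 2 * ((k - 1) * (k - 2) * (1 - 4 / ((n : ℝ) - 1)) ^ t +
    (k ^ 2 - 3 * k) * (1 - 4 / (n : ℝ)) ^ t) + 1 + (k - 1) * (1 - 2 / ((n : ℝ) - 1)) ^ t

lemma walk_var {k : ℕ} (hkn : k + 3 ≤ n) (t : ℕ) :
    ∑ σ, walk n k t σ * (ff σ - 1) ^ 2 = VV n k t := by
  have h0 := walk_sum (by omega : k + 2 ≤ n) t
  have h1 := walk_f hkn t
  rw [VV, ← walk_h hkn t, ← walk_g hkn t, ← h1]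
  have h0' : ∀ a b c : ℝ, a + 1 + b = c ↔ a + (∑ σ, walk n k t σ) + b = c := by
    intro a b c; rw [h0]
  refine Eq.symm ((h0' _ _ _).2 ?_)
  rw [← Finset.sum_add_distrib, Finset.mul_sum, ← Finset.sum_add_distrib, ← Finset.sum_add_distrib]
  refine Finset.sum_congr rfl fun σ _ => ?_
  ring

lemma tv_lower {k : ℕ} (t : ℕ) (hk : 1 ≤ k) (hkn : k + 3 ≤ n) :
    (k - 1) * (1 - 2 / ((n : ℝ) - 1)) ^ t ≤
      tvDist (walk n k t) (stationary n k (t + 1)) +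
      √(tvDist (walk n k t) (stationary n k (t + 1)) * VV n k t) := by
  have hn : 4 ≤ n := by omega
  have hk2 : k + 2 ≤ n := by omega
  have hsum : ∑ σ, walk n k t σ = ∑ σ, stationary n k (t + 1) σ := by
    rw [walk_sum hk2, stationary_sum t hn hk2]
  set w := walk n k t with hw
  set u := stationary n k (t + 1) with hu
  have hu0 : ∀ σ, 0 ≤ u σ := by
    intro σ
    rw [hu, stationary_eq t hk2]; exact div_nonneg (wt_nonneg _ _ _) (Nat.cast_nonneg _)
  have d1 : tvDist w u = ∑ σ, max (u σ - w σ) 0 := tv_eq _ _ hsum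
  have d2 : tvDist w u = ∑ σ, max (w σ - u σ) 0 := by
    rw [← tv_eq u w hsum.symm, tvDist, tvDist]
    congr 1
    exact Finset.sum_congr rfl fun σ _ => abs_sub_comm _ _
  have hE : ∑ σ, u σ * (ff σ - 1) = 0 := by
    have hf : (n.factorial : ℝ) ≠ 0 := by exact_mod_cast n.factorial_ne_zero
    have e : ∀ σ, u σ * (ff σ - 1) =
        (n.factorial : ℝ)⁻¹ * (wt n k t σ * ((fixset σ).card : ℝ) - wt n k t σ) := by
      intro σ; rw [hu, stationary_eq t hk2, ff]; field_simp
    rw [Finset.sum_congr rfl fun σ _ => e σ, ← Finset.mul_sum, Finset.sum_sub_distrib,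
      wt_fix k t hn, wt_tot k t hn]; simp
  rw [← walk_f hkn t, ← hw]
  have hs : ∑ σ, w σ * (ff σ - 1) ≤
      ∑ σ, max (u σ - w σ) 0 + ∑ σ, √(max (w σ - u σ) 0) * √(w σ * (ff σ - 1) ^ 2) := by
    have hsub : ∑ σ, w σ * (ff σ - 1) = ∑ σ, (w σ * (ff σ - 1) - u σ * (ff σ - 1)) := by
      rw [Finset.sum_sub_distrib, hE, sub_zero]
    rw [hsub, ← Finset.sum_add_distrib]
    refine Finset.sum_le_sum fun σ _ => ?_
    have hf0 : 0 ≤ ff σ := Nat.cast_nonneg _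
    have hw0 : 0 ≤ w σ := walk_nonneg k t σ
    rcases le_total (w σ) (u σ) with h | h
    · rw [max_eq_left (by linarith), max_eq_right (by linarith)]
      simp only [Real.sqrt_zero, zero_mul, add_zero]
      nlinarith
    · rw [max_eq_right (by linarith), max_eq_left (by linarith), zero_add,
        ← Real.sqrt_mul (by linarith)]
      apply Real.le_sqrt_of_sq_le
      have h1 : (w σ - u σ) ^ 2 ≤ (w σ - u σ) * w σ := by
        have := hu0 σ
        nlinarith
      have := mul_le_mul_of_nonneg_right h1 (sq_nonneg (ff σ - 1))
      linarith
  refine hs.trans ?_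
  rw [← d1]
  apply add_le_add_right
  refine (Real.sum_sqrt_mul_sqrt_le univ (fun σ => le_max_right _ _)
    (fun σ => mul_nonneg (walk_nonneg k t σ) (sq_nonneg _))).trans ?_
  rw [← d2, walk_var hkn t, Real.sqrt_mul (tv_nonneg _ _)]

end moments
end HookWalk

open Finset Filter Real

namespace HookWalk

theorem final_quadratic {x s : ℝ} (hx0 : 0 < x) (hx1 : x < 1) (hs0 : 0 < s) (hs1 : s ≤ x / 2) :
    1 / 12 * x ^ 2 * (1 + (x - s) + (x ^ 2 - 3 * x * s + s ^ 2)) <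
      (x - s - 1 / 12 * x ^ 2) ^ 2 := by
  obtain ⟨a, hax⟩ : ∃ a : ℝ, x - s = a * x := ⟨(x - s) / x, by field_simp⟩
  have hse : s = x - a * x := by linarith
  have ha2 : 1 / 2 ≤ a := by
    by_contra hcon
    push Not at hcon
    nlinarith [mul_pos hx0 (sub_pos.mpr hcon)]
  have ha1 : a ≤ 1 := by
    by_contra hcon
    push Not at hcon
    nlinarith [mul_pos hx0 (sub_pos.mpr hcon)]
  have h1 : 1 + (x - s) + (x ^ 2 - 3 * x * s + s ^ 2) ≤ 1 + a + a ^ 2 := by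
    have e1 : x ^ 2 - 3 * x * s + s ^ 2 ≤ (x - s) ^ 2 := by nlinarith [mul_pos hx0 hs0]
    have e2 : x - s ≤ a := by rw [hax]; nlinarith
    have e3 : (x - s) ^ 2 ≤ a ^ 2 := pow_le_pow_left₀ (by linarith) e2 2
    linarith
  have h2 : (a - 1 / 12) ^ 2 ≤ (a - x / 12) ^ 2 :=
    pow_le_pow_left₀ (by linarith) (by linarith) 2
  have h3 : 1 / 12 * (1 + a + a ^ 2) < (a - 1 / 12) ^ 2 := by
    nlinarith [mul_nonneg (sub_nonneg.mpr ha2) (sub_nonneg.mpr ha2)]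
  have hx2 : 0 < x ^ 2 := by positivity
  calc 1 / 12 * x ^ 2 * (1 + (x - s) + (x ^ 2 - 3 * x * s + s ^ 2))
      ≤ 1 / 12 * x ^ 2 * (1 + a + a ^ 2) := mul_le_mul_of_nonneg_left h1 (by positivity)
    _ = x ^ 2 * (1 / 12 * (1 + a + a ^ 2)) := by ring
    _ < x ^ 2 * (a - x / 12) ^ 2 := mul_lt_mul_of_pos_left (h3.trans_le h2) hx2
    _ = (x - s - 1 / 12 * x ^ 2) ^ 2 := by rw [hax]; ring

open Equiv Topology

section limits

lemma pow_lim (b : ℕ → ℝ) (β L : ℝ) (T : ℕ → ℕ)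
    (hb : Tendsto (fun n : ℕ => (n : ℝ) * b n) atTop (𝓝 β))
    (hpos : ∀ᶠ n : ℕ in atTop, b n ≤ 1)
    (hT : Tendsto (fun n : ℕ => (T n : ℝ) / n) atTop (𝓝 L)) :
    Tendsto (fun n : ℕ => (1 - b n) ^ T n) atTop (𝓝 (Real.exp (-(β * L)))) := by
  have h1 : Tendsto (fun n : ℕ => (1 + -b n) ^ n) atTop (𝓝 (Real.exp (-β))) := by
    apply Real.tendsto_one_add_pow_exp_of_tendsto
    simpa using hb.neg
  have h2 := h1.rpow hT (Or.inl (Real.exp_pos _).ne')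
  rw [← Real.exp_mul] at h2
  rw [show -(β * L) = -β * L by ring]
  refine h2.congr' ?_
  filter_upwards [hpos, eventually_gt_atTop 0] with n hn hn0
  have : (n : ℝ) ≠ 0 := by exact_mod_cast hn0.ne'
  rw [← Real.rpow_natCast, ← Real.rpow_mul (by linarith), mul_div_cancel₀ _ this, Real.rpow_natCast]
  rfl

lemma sub_atTop (a : ℝ) : Tendsto (fun n : ℕ => (n : ℝ) - a) atTop atTop :=
  tendsto_atTop_add_const_right _ (-a) tendsto_natCast_atTop_atTop

lemma div_lim (β : ℝ) : Tendsto (fun n : ℕ => (n : ℝ) * (β / ((n : ℝ) - 1))) atTop (𝓝 β) := by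
  have h : Tendsto (fun n : ℕ => β + β / ((n : ℝ) - 1)) atTop (𝓝 (β + 0)) :=
    tendsto_const_nhds.add ((sub_atTop 1).const_div_atTop β)
  rw [add_zero] at h
  refine h.congr' ?_
  filter_upwards [eventually_ge_atTop 2] with n hn
  have : (2 : ℝ) ≤ n := by exact_mod_cast hn
  have : (n : ℝ) - 1 ≠ 0 := by linarith
  field_simp; ring

lemma div_lim' (β : ℝ) : Tendsto (fun n : ℕ => (n : ℝ) * (β / (n : ℝ))) atTop (𝓝 β) := by
  refine tendsto_const_nhds.congr' ?_
  filter_upwards [eventually_ge_atTop 2] with n hn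
  have : (n : ℝ) ≠ 0 := by positivity
  field_simp

lemma small1 (β : ℝ) : ∀ᶠ n : ℕ in atTop, β / ((n : ℝ) - 1) ≤ 1 := by
  have h := (sub_atTop 1).const_div_atTop β
  exact (h.eventually (Iio_mem_nhds zero_lt_one)).mono fun n h => le_of_lt h

lemma small0 (β : ℝ) : ∀ᶠ n : ℕ in atTop, β / (n : ℝ) ≤ 1 := by
  have h := (tendsto_natCast_atTop_atTop (R := ℝ)).const_div_atTop β
  exact (h.eventually (Iio_mem_nhds zero_lt_one)).mono fun n h => le_of_lt h

/-- number of steps -/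
noncomputable def TT (c : ℝ) (k n : ℕ) : ℕ := ⌊c * (n : ℝ) + (n : ℝ) / 2 * Real.log k⌋₊

lemma TT_lim (c : ℝ) (hc : 0 < c) (k : ℕ) (hk : 2 ≤ k) :
    Tendsto (fun n : ℕ => (TT c k n : ℝ) / n) atTop (𝓝 (c + Real.log k / 2)) := by
  have hl : 0 ≤ Real.log k := Real.log_natCast_nonneg k
  have h := (tendsto_nat_floor_mul_div_atTop (R := ℝ) (a := c + Real.log k / 2)
    (by linarith)).comp (tendsto_natCast_atTop_atTop (R := ℝ))
  refine h.congr fun n => ?_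
  simp only [Function.comp, TT]
  congr 3
  ring

lemma exp_val (c : ℝ) (k : ℕ) (hk : 2 ≤ k) :
    Real.exp (-(2 * (c + Real.log k / 2))) = Real.exp (-2 * c) / k := by
  have hk0 : (0 : ℝ) < k := by positivity
  rw [show -(2 * (c + Real.log k / 2)) = -2 * c - Real.log k by ring, Real.exp_sub, Real.exp_log hk0]

lemma exp_val4 (c : ℝ) (k : ℕ) (hk : 2 ≤ k) :
    Real.exp (-(4 * (c + Real.log k / 2))) = (Real.exp (-2 * c) / k) ^ 2 := by
  rw [← exp_val c k hk, ← Real.exp_nat_mul]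
  congr 1; push_cast; ring

lemma lim_r1 (c : ℝ) (hc : 0 < c) (k : ℕ) (hk : 2 ≤ k) : Tendsto (fun n : ℕ => (1 - 2 / ((n : ℝ) - 1)) ^ TT c k n) atTop
    (𝓝 (Real.exp (-2 * c) / k)) := by
  rw [← exp_val c k hk]
  exact pow_lim _ 2 _ _ (div_lim 2) (small1 2) (TT_lim c hc k hk)

lemma lim_r0 (c : ℝ) (hc : 0 < c) (k : ℕ) (hk : 2 ≤ k) : Tendsto (fun n : ℕ => (1 - 2 / (n : ℝ)) ^ TT c k n) atTop
    (𝓝 (Real.exp (-2 * c) / k)) := by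
  rw [← exp_val c k hk]
  exact pow_lim _ 2 _ _ (div_lim' 2) (small0 2) (TT_lim c hc k hk)

lemma lim_r14 (c : ℝ) (hc : 0 < c) (k : ℕ) (hk : 2 ≤ k) : Tendsto (fun n : ℕ => (1 - 4 / ((n : ℝ) - 1)) ^ TT c k n) atTop
    (𝓝 ((Real.exp (-2 * c) / k) ^ 2)) := by
  rw [← exp_val4 c k hk]
  exact pow_lim _ 4 _ _ (div_lim 4) (small1 4) (TT_lim c hc k hk)

lemma lim_r04 (c : ℝ) (hc : 0 < c) (k : ℕ) (hk : 2 ≤ k) : Tendsto (fun n : ℕ => (1 - 4 / (n : ℝ)) ^ TT c k n) atTop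
    (𝓝 ((Real.exp (-2 * c) / k) ^ 2)) := by
  rw [← exp_val4 c k hk]
  exact pow_lim _ 4 _ _ (div_lim' 4) (small0 4) (TT_lim c hc k hk)

lemma lim_psi (c : ℝ) (hc : 0 < c) (k : ℕ) (hk : 2 ≤ k) : Tendsto (fun n : ℕ => psi n k (TT c k n) 0) atTop
    (𝓝 (Real.exp (-2 * c) / k)) := by
  have h1 : Tendsto (fun n : ℕ => (1 - 2 / ((n : ℝ) - 1)) ^ k) atTop (𝓝 1) := by
    have := (((sub_atTop 1).const_div_atTop (2 : ℝ)).const_sub 1).pow k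
    simpa using this
  have h2 : Tendsto (fun n : ℕ => 2 * ((k : ℝ) - (0 : ℕ)) / ((n : ℝ) - k)) atTop (𝓝 0) :=
    (sub_atTop k).const_div_atTop _
  have h3 := ((lim_r1 c hc k hk).div h1 one_ne_zero).add h2
  rw [div_one, add_zero] at h3
  exact h3

lemma lim_first (c : ℝ) (hc : 0 < c) (k : ℕ) (hk : 2 ≤ k) : Tendsto (fun n : ℕ => (TT c k n : ℝ) * (k : ℝ) ^ 2 / (n * (n - 1))) atTop
    (𝓝 0) := by
  have h := (TT_lim c hc k hk).mul ((sub_atTop 1).const_div_atTop ((k : ℝ) ^ 2))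
  rw [mul_zero] at h
  refine h.congr fun n => ?_
  rw [div_mul_div_comm]

lemma xs_facts (c : ℝ) (hc : 0 < c) (k : ℕ) (hk : 2 ≤ k) : 0 < Real.exp (-2 * c) ∧ Real.exp (-2 * c) < 1 ∧ 0 < Real.exp (-2 * c) / k ∧
    Real.exp (-2 * c) / k ≤ Real.exp (-2 * c) / 2 := by
  have hk0 : (0 : ℝ) < k := by positivity
  have h2 : (2 : ℝ) ≤ k := by exact_mod_cast hk
  refine ⟨Real.exp_pos _, ?_, div_pos (Real.exp_pos _) hk0, ?_⟩
  · rw [Real.exp_lt_one_iff]; linarith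
  · exact div_le_div_of_nonneg_left (Real.exp_pos _).le (by norm_num) h2

lemma upper_final (c : ℝ) (hc : 0 < c) (k : ℕ) (hk : 2 ≤ k) : Filter.limsup (fun n : ℕ =>
      tvDist (walk n k (TT c k n)) (stationary n k (TT c k n + 1))) atTop ≤
    Real.sqrt ((Real.exp 1 - 1) / 2) * Real.exp (-2 * c) := by
  obtain ⟨hx0, hx1, hs0, hs1⟩ := xs_facts c hc k hk
  have hk0 : (0 : ℝ) < k := by positivity
  set x := Real.exp (-2 * c) with hx
  set s := x / k with hs
  have hden : 0 < 1 - s ^ 2 := by nlinarith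
  have hlim : Tendsto (fun n : ℕ => (TT c k n : ℝ) * (k : ℝ) ^ 2 / (n * (n - 1)) +
      1 / 2 * (k * (1 - 2 / (n : ℝ)) ^ TT c k n) +
      1 / 2 * √(2 * (psi n k (TT c k n) 0 ^ 2 / (1 - psi n k (TT c k n) 0 ^ 2)))) atTop
      (𝓝 (0 + 1 / 2 * (k * s) + 1 / 2 * √(2 * (s ^ 2 / (1 - s ^ 2))))) := by
    have hp := (lim_psi c hc k hk).pow 2
    refine ((lim_first c hc k hk).add (((lim_r0 c hc k hk).const_mul _).const_mul _)).add ?_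
    refine Tendsto.const_mul _ (Tendsto.sqrt (Tendsto.const_mul _ ?_))
    exact hp.div (hp.const_sub 1) hden.ne'
  have hev : ∀ᶠ n : ℕ in atTop, tvDist (walk n k (TT c k n)) (stationary n k (TT c k n + 1)) ≤
      (TT c k n : ℝ) * (k : ℝ) ^ 2 / (n * (n - 1)) +
      1 / 2 * (k * (1 - 2 / (n : ℝ)) ^ TT c k n) +
      1 / 2 * √(2 * (psi n k (TT c k n) 0 ^ 2 / (1 - psi n k (TT c k n) 0 ^ 2))) := by
    have hp1 : ∀ᶠ n : ℕ in atTop, psi n k (TT c k n) 0 < 1 :=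
      (lim_psi c hc k hk).eventually (Iio_mem_nhds (by linarith : s < 1))
    filter_upwards [hp1, eventually_ge_atTop (k + 3)] with n h1 h2
    exact tv_upper (TT c k n) (by omega) h2 h1
  have hl := limsup_le_limsup hev
    (isCoboundedUnder_le_of_eventually_le (x := 0) _ (Eventually.of_forall fun n => tv_nonneg _ _))
    hlim.isBoundedUnder_le
  rw [hlim.limsup_eq] at hl
  refine hl.trans ?_
  have hks : (k : ℝ) * s = x := by rw [hs]; field_simp
  rw [hks]
  have h1 : √(2 * (s ^ 2 / (1 - s ^ 2))) ≤ 0.82 * x := by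
    rw [Real.sqrt_le_left (by positivity), ← mul_div_assoc, div_le_iff₀ hden]
    have q1 : s ^ 2 ≤ x ^ 2 / 4 := by nlinarith
    have q2 : x ^ 2 ≤ 1 := by nlinarith
    have q3 : 0 < x ^ 2 := by positivity
    have q4 : x ^ 2 * (1 - s ^ 2) ≥ x ^ 2 * (3 / 4) :=
      mul_le_mul_of_nonneg_left (by linarith) q3.le
    nlinarith
  have h2 : (0.91 : ℝ) ≤ √((Real.exp 1 - 1) / 2) := by
    apply Real.le_sqrt_of_sq_le
    have := Real.exp_one_gt_d9
    norm_num at *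
    linarith
  have := mul_le_mul_of_nonneg_right h2 hx0.le
  linarith

lemma lower_final (c : ℝ) (hc : 0 < c) (k : ℕ) (hk : 2 ≤ k) : (1 / 12) * Real.exp (-4 * c) ≤ Filter.liminf (fun n : ℕ =>
      tvDist (walk n k (TT c k n)) (stationary n k (TT c k n + 1))) atTop := by
  obtain ⟨hx0, hx1, hs0, hs1⟩ := xs_facts c hc k hk
  have h2k : (2 : ℝ) ≤ k := by exact_mod_cast hk
  have hk0 : (0 : ℝ) < k := by positivity
  have hx4 : Real.exp (-4 * c) = Real.exp (-2 * c) ^ 2 := by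
    rw [← Real.exp_nat_mul]; congr 1; push_cast; ring
  have hR1 := lim_r1 c hc k hk
  have hR14 := lim_r14 c hc k hk
  have hR04 := lim_r04 c hc k hk
  rw [hx4]
  set x := Real.exp (-2 * c) with hx
  set s := x / k with hs
  have hks : (k : ℝ) * s = x := by rw [hs]; field_simp
  set V : ℝ := 1 / 2 * ((k - 1) * (k - 2) * s ^ 2 + (k ^ 2 - 3 * k) * s ^ 2) + 1 + (k - 1) * s with hV
  have hVlim : Tendsto (fun n : ℕ => VV n k (TT c k n)) atTop (𝓝 V) :=
    ((((hR14.const_mul _).add (hR04.const_mul _)).const_mul _).add_const 1).add (hR1.const_mul _)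
  set y : ℝ := 1 / 12 * x ^ 2 with hy
  have hstrict : y + √(y * V) < (k - 1) * s := by
    -- put a = (k-1)/k
    have ha : (k - 1) * s = x - s := by rw [← hks]; ring
    have hVe : V = 1 + (x - s) + (x ^ 2 - 3 * x * s + s ^ 2) := by
      rw [hV, ← hks]; ring
    rw [ha]
    have hpos : 0 < x - s - y := by rw [hy]; nlinarith
    have hsq : √(y * V) < x - s - y := by
      rw [Real.sqrt_lt' hpos, hVe, hy]
      exact final_quadratic hx0 hx1 hs0 hs1
    linarith
  have hlim : Tendsto (fun n : ℕ => (k - 1) * (1 - 2 / ((n : ℝ) - 1)) ^ TT c k n -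
      (y + √(y * VV n k (TT c k n)))) atTop (𝓝 ((k - 1) * s - (y + √(y * V)))) :=
    (hR1.const_mul _).sub (((hVlim.const_mul y).sqrt).const_add y)
  have hev : ∀ᶠ n : ℕ in atTop,
      0 < (k - 1) * (1 - 2 / ((n : ℝ) - 1)) ^ TT c k n - (y + √(y * VV n k (TT c k n))) :=
    hlim.eventually (Ioi_mem_nhds (by linarith))
  have hb1 : ∀ᶠ n : ℕ in atTop,
      tvDist (walk n k (TT c k n)) (stationary n k (TT c k n + 1)) ≤ 1 := by
    filter_upwards [eventually_ge_atTop (k + 3)] with n hn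
    exact tv_le_one _ (by omega) (by omega)
  refine le_liminf_of_le (isCoboundedUnder_ge_of_eventually_le _ hb1) ?_
  filter_upwards [hev, eventually_ge_atTop (k + 3)] with n h1 hn
  by_contra hlt
  push Not at hlt
  have hl := tv_lower (TT c k n) (by omega : 1 ≤ k) hn
  have hVn : 0 ≤ VV n k (TT c k n) := by
    rw [← walk_var hn]
    exact Finset.sum_nonneg fun σ _ => mul_nonneg (walk_nonneg _ _ _) (sq_nonneg _)
  have := Real.sqrt_le_sqrt (mul_le_mul_of_nonneg_right hlt.le hVn)
  linarith

end limits
end HookWalk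

/-- Theorem 2: for a fixed `k ≥ 2`, after a random `(n-k)`-cycle and
`t_n = ⌊cn + (n/2)ln k⌋` random transpositions,
`(1/12)e^{-4c} ≤ liminf ‖μ_{t_n+1} - U_{t_n+1}‖_TV` and
`limsup ‖μ_{t_n+1} - U_{t_n+1}‖_TV ≤ √((e-1)/2)·e^{-2c}`. -/
theorem cycle_walk_n_sub_k_tv_bounds (k : ℕ) (hk : 2 ≤ k) (c : ℝ) (hc : 0 < c) :
    (1 / 12) * Real.exp (-4 * c) ≤
      Filter.liminf (fun n : ℕ =>
        tvDist (walk n k ⌊c * (n : ℝ) + (n : ℝ) / 2 * Real.log k⌋₊)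
          (stationary n k (⌊c * (n : ℝ) + (n : ℝ) / 2 * Real.log k⌋₊ + 1)))
        Filter.atTop ∧
    Filter.limsup (fun n : ℕ =>
        tvDist (walk n k ⌊c * (n : ℝ) + (n : ℝ) / 2 * Real.log k⌋₊)
          (stationary n k (⌊c * (n : ℝ) + (n : ℝ) / 2 * Real.log k⌋₊ + 1)))
        Filter.atTop ≤
      Real.sqrt ((Real.exp 1 - 1) / 2) * Real.exp (-2 * c) := by
  exact ⟨HookWalk.lower_final c hc k hk, HookWalk.upper_final c hc k hk⟩
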